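/- arXiv:2303.11740 — 2 statements merged into one kernel-verified Lean document; each statement's English description precedes it below -/
import Mathlib

section
/- Let W ⊂ ℚ_p(X) be a residually algebraic torsion extension of ℤ_p, and let E = {s_n}_{n∈ℕ} and E' = {t_n}_{n∈ℕ} be strongly stacked sequences in Q̄_p, with gauges {δ_n} and {δ'_n} respectively, such that W = ℤ_{p,E} = ℤ_{p,E'}. Then for every n ∈ ℕ: (i) [ℚ_p(s_n):ℚ_p] = [ℚ_p(t_n):ℚ_p] and δ_n = δ'_n; (ii) the ramification index and residue degree of ℚ_p(s_n)/ℚ_p equal those of ℚ_p(t_n)/ℚ_p. -/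
open Polynomial Filter

noncomputable section

/-- An additive `ℚ`-valued valuation on a field `K` (written additively, with `v 0 = ⊤`). -/
structure AddVal (K : Type) [Field K] where
  v : K → WithTop ℚ
  v_eq_top_iff : ∀ x : K, v x = ⊤ ↔ x = 0
  v_mul : ∀ x y : K, v (x * y) = v x + v y
  min_le_v_add : ∀ x y : K, min (v x) (v y) ≤ v (x + y)

namespace AddVal

variable {K : Type} [Field K] (w : AddVal K)

/-- A Cauchy sequence with respect to an additive valuation. -/
def IsCauchySeq (s : ℕ → K) : Prop :=
  ∀ γ : ℚ, ∃ N : ℕ, ∀ m ≥ N, ∀ n ≥ N, (γ : WithTop ℚ) < w.v (s m - s n)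

/-- Convergence of a sequence to a limit, with respect to an additive valuation. -/
def TendsToVal (s : ℕ → K) (l : K) : Prop :=
  ∀ γ : ℚ, ∃ N : ℕ, ∀ n ≥ N, (γ : WithTop ℚ) < w.v (s n - l)

/-- A pseudo-convergent sequence: `v (s n - s m) < v (s m - s k)` for `n < m < k`. -/
def IsPseudoConvergent (s : ℕ → K) : Prop :=
  ∀ ⦃n m k : ℕ⦄, n < m → m < k → w.v (s n - s m) < w.v (s m - s k)

/-- A sequence is of transcendental type over a subring (mapped in via `g`) if for every
polynomial `f` over that ring the sequence `v (f (s n))` is eventually constant. -/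
def IsTranscendentalTypeOver {R : Type} [CommRing R] (g : R →+* K) (s : ℕ → K) : Prop :=
  ∀ f : Polynomial R, ∃ N : ℕ, ∀ m ≥ N, ∀ n ≥ N,
    w.v (f.eval₂ g (s m)) = w.v (f.eval₂ g (s n))

/-- A sequence of transcendental type: for every polynomial `f ∈ K[X]`, `v (f (s n))` is
eventually constant. -/
def IsTranscendentalType (s : ℕ → K) : Prop :=
  w.IsTranscendentalTypeOver (RingHom.id K) s

/-- `α` is a pseudo-limit of `s` when `v (s n - α)` is strictly increasing. -/
def IsPseudoLimit (s : ℕ → K) (α : K) : Prop :=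
  StrictMono fun n => w.v (s n - α)

/-- The breadth ideal of a pseudo-convergent sequence. -/
def breadth (s : ℕ → K) : Set K :=
  {x : K | ∀ n : ℕ, w.v (s (n + 1) - s n) < w.v x}

/-- Equivalence of pseudo-convergent sequences. -/
def SeqEquiv (s t : ℕ → K) : Prop :=
  w.breadth s = w.breadth t ∧
    ∀ k : ℕ, ∃ i₀ j₀ : ℕ, ∀ i ≥ i₀, ∀ j ≥ j₀, w.v (s (k + 1) - s k) < w.v (s i - t j)

end AddVal

/-- `α` is transcendental over the image of `g`. -/
def IsTranscOver {R K : Type} [CommRing R] [Field K] (g : R →+* K) (α : K) : Prop :=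
  ∀ f : Polynomial R, f ≠ 0 → f.eval₂ g α ≠ 0
/-- A fixed algebraic closure of `ℚ_p`. -/
abbrev Qpbar (p : ℕ) [Fact p.Prime] : Type := AlgebraicClosure ℚ_[p]

/-- The unique extension of the `p`-adic valuation to the algebraic closure of `ℚ_p`,
presented as an additive `ℚ`-valued valuation extending `Padic.valuation`. -/
structure PadicSetup (p : ℕ) [Fact p.Prime] where
  vbar : AddVal (Qpbar p)
  vbar_extends : ∀ x : ℚ_[p], x ≠ 0 →
    vbar.v (algebraMap ℚ_[p] (Qpbar p) x) = ((x.valuation : ℚ) : WithTop ℚ)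

/-- A model of `ℂ_p`: a complete valued field in which `Q̄_p` embeds isometrically
and densely. -/
structure CpSetup (p : ℕ) [Fact p.Prime] extends PadicSetup p where
  Cp : Type
  [fieldCp : Field Cp]
  emb : Qpbar p →+* Cp
  vC : AddVal Cp
  vC_emb : ∀ x : Qpbar p, vC.v (emb x) = vbar.v x
  complete : ∀ s : ℕ → Cp, vC.IsCauchySeq s → ∃ l : Cp, vC.TendsToVal s l
  dense : ∀ y : Cp, ∃ s : ℕ → Qpbar p, vC.TendsToVal (fun n => emb (s n)) y

attribute [instance] CpSetup.fieldCp

variable (p : ℕ) [Fact p.Prime]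

/-- The degree `[ℚ_p(x) : ℚ_p]` of an element of the algebraic closure of `ℚ_p`. -/
def degOf (x : Qpbar p) : ℕ :=
  Module.finrank ℚ_[p] ↥(IntermediateField.adjoin ℚ_[p] {x})

/-- A stacked sequence in `Q̄_p`: `s 0 ∈ ℚ_p`, the degrees `[ℚ_p(s n) : ℚ_p]` are strictly
increasing, and each `(s n, v (s (n+1) - s n))` is a minimal pair. -/
structure IsStacked (S : PadicSetup p) (s : ℕ → Qpbar p) : Prop where
  first : ∃ c : ℚ_[p], s 0 = algebraMap ℚ_[p] (Qpbar p) c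
  deg_lt : ∀ n : ℕ, degOf p (s n) < degOf p (s (n + 1))
  min_pair : ∀ n : ℕ, ∀ c : Qpbar p, degOf p c < degOf p (s n) →
    S.vbar.v (s n - c) < S.vbar.v (s (n + 1) - s n)

/-- A strongly stacked sequence: moreover each pair `(s n, s (n+1))` is distinguished. -/
structure IsStronglyStacked (S : PadicSetup p) (s : ℕ → Qpbar p) extends
    IsStacked p S s : Prop where
  dist : ∀ n : ℕ, ∀ c : Qpbar p, degOf p c < degOf p (s (n + 1)) →
    S.vbar.v (s (n + 1) - c) ≤ S.vbar.v (s (n + 1) - s n)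

/-- The canonical map `ℚ → Q̄_p`. -/
def qHomQpbar : ℚ →+* Qpbar p :=
  (algebraMap ℚ_[p] (Qpbar p)).comp (Rat.castHom ℚ_[p])

/-- The ring `ℤ_{p,E}` (as a subset of `ℚ_p(X)`) attached to a sequence `E ⊆ Q̄_p`:
rational functions mapping almost all the `s n` into `Z̄_p`. -/
def ZpE (S : PadicSetup p) (s : ℕ → Qpbar p) : Set (RatFunc ℚ_[p]) :=
  {φ : RatFunc ℚ_[p] | ∀ᶠ n in atTop,
    φ.denom.eval₂ (algebraMap ℚ_[p] (Qpbar p)) (s n) ≠ 0 ∧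
      0 ≤ S.vbar.v (φ.eval (algebraMap ℚ_[p] (Qpbar p)) (s n))}

/-- The ring `ℤ_{(p),E}` (as a subset of `ℚ(X)`) attached to a sequence `E ⊆ Q̄_p`. -/
def ZplE (S : PadicSetup p) (s : ℕ → Qpbar p) : Set (RatFunc ℚ) :=
  {φ : RatFunc ℚ | ∀ᶠ n in atTop,
    φ.denom.eval₂ (qHomQpbar p) (s n) ≠ 0 ∧
      0 ≤ S.vbar.v (φ.eval (qHomQpbar p) (s n))}

/-- `W` is a residually algebraic torsion extension of `ℤ_p` to `ℚ_p(X)`: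
`W ∩ ℚ_p = ℤ_p`, the residue field of `W` is algebraic over `𝔽_p`, and the value group of `W`
is contained in the divisible hull of the value group of `ℤ_p`. -/
def IsResAlgTorsionQp (W : ValuationSubring (RatFunc ℚ_[p])) : Prop :=
  (∀ c : ℚ_[p], RatFunc.C c ∈ W ↔ ‖c‖ ≤ 1) ∧
  (∀ x : IsLocalRing.ResidueField W, ∃ k : ℕ, 1 ≤ k ∧ x ^ p ^ k = x) ∧
  (∀ φ : RatFunc ℚ_[p], φ ≠ 0 → ∃ n : ℕ, 1 ≤ n ∧ ∃ c : ℚ_[p], c ≠ 0 ∧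
    φ ^ n / RatFunc.C c ∈ W ∧ RatFunc.C c / φ ^ n ∈ W)

/-- `W` is a residually algebraic torsion extension of `ℤ_(p)` to `ℚ(X)`. -/
def IsResAlgTorsionQ (W : ValuationSubring (RatFunc ℚ)) : Prop :=
  (∀ c : ℚ, RatFunc.C c ∈ W ↔ ‖(c : ℚ_[p])‖ ≤ 1) ∧
  (∀ x : IsLocalRing.ResidueField W, ∃ k : ℕ, 1 ≤ k ∧ x ^ p ^ k = x) ∧
  (∀ φ : RatFunc ℚ, φ ≠ 0 → ∃ n : ℕ, 1 ≤ n ∧ ∃ c : ℚ, c ≠ 0 ∧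
    φ ^ n / RatFunc.C c ∈ W ∧ RatFunc.C c / φ ^ n ∈ W)

/-- The set of (rational) values of the valuation on an intermediate field of `Q̄_p/ℚ_p`. -/
def valSetF (S : PadicSetup p) (F : IntermediateField ℚ_[p] (Qpbar p)) : Set ℚ :=
  {γ : ℚ | ∃ a ∈ F, S.vbar.v a = (γ : WithTop ℚ)}

/-- The value group (as a set of rationals) of `ℚ_p(x)` for `x ∈ Q̄_p`. -/
def valSetElem (S : PadicSetup p) (x : Qpbar p) : Set ℚ :=
  valSetF p S (IntermediateField.adjoin ℚ_[p] {x})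

/-- The residue field of `F` is contained in the residue field of `F'` (inside the residue
field of `Z̄_p`). -/
def resSub (S : PadicSetup p) (F F' : IntermediateField ℚ_[p] (Qpbar p)) : Prop :=
  ∀ a ∈ F, 0 ≤ S.vbar.v a → ∃ b ∈ F', 0 ≤ S.vbar.v b ∧ 0 < S.vbar.v (a - b)

/-- A subset `Γ ⊆ ℚ` (a value group) has bounded denominators, i.e. finite ramification
over `ℤ`. -/
def HasFiniteRamification (Γ : Set ℚ) : Prop :=
  ∃ e : ℕ, 0 < e ∧ ∀ γ ∈ Γ, ∃ k : ℤ, (e : ℚ) * γ = (k : ℚ)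

/-- The ramification index of `Γ₁` over `Γ₀`: the least positive integer `e` with
`e • Γ₁ ⊆ Γ₀` (for the value groups of finite extensions of `ℚ_p` this is the index
`[Γ₁ : Γ₀]`). -/
def ramIdx (Γ₀ Γ₁ : Set ℚ) : ℕ :=
  sInf {e : ℕ | 0 < e ∧ ∀ γ ∈ Γ₁, (e : ℚ) * γ ∈ Γ₀}

/-- The value group of `ℚ_p` (normalized): the integers, as a subset of `ℚ`. -/
def zSet : Set ℚ := Set.range ((↑) : ℤ → ℚ)

/-- The maximal unramified extension of a finite extension `K` of `ℚ_p` inside `Q̄_p`: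
the set of `x` with `K(x)/K` unramified. -/
def maxUnramified (S : PadicSetup p) (K : IntermediateField ℚ_[p] (Qpbar p)) :
    Set (Qpbar p) :=
  {x : Qpbar p | valSetF p S (K ⊔ IntermediateField.adjoin ℚ_[p] {x}) = valSetF p S K}

section CpDefs

variable (S : CpSetup p)

/-- The canonical map `ℚ_p → ℂ_p`. -/
def qpHomC : ℚ_[p] →+* S.Cp :=
  S.emb.comp (algebraMap ℚ_[p] (Qpbar p))

/-- The canonical map `ℚ → ℂ_p`. -/
def qHomC : ℚ →+* S.Cp :=
  (qpHomC p S).comp (Rat.castHom ℚ_[p])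

/-- The valuation domain `ℤ_{p,α} = {φ ∈ ℚ_p(X) : φ(α) ∈ O_p}` (as a subset of `ℚ_p(X)`). -/
def Zpa (α : S.Cp) : Set (RatFunc ℚ_[p]) :=
  {φ : RatFunc ℚ_[p] | φ.denom.eval₂ (qpHomC p S) α ≠ 0 ∧
    0 ≤ S.vC.v (φ.eval (qpHomC p S) α)}

/-- The valuation domain `ℤ_{(p),α} = {φ ∈ ℚ(X) : φ(α) ∈ O_p}` (as a subset of `ℚ(X)`). -/
def Zpla (α : S.Cp) : Set (RatFunc ℚ) :=
  {φ : RatFunc ℚ | φ.denom.eval₂ (qHomC p S) α ≠ 0 ∧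
    0 ≤ S.vC.v (φ.eval (qHomC p S) α)}

/-- Membership in the subfield `ℚ_p(α)` of `ℂ_p`. -/
def InQpAlpha (α x : S.Cp) : Prop :=
  ∃ f g : Polynomial ℚ_[p], g.eval₂ (qpHomC p S) α ≠ 0 ∧
    x = f.eval₂ (qpHomC p S) α / g.eval₂ (qpHomC p S) α

/-- The value group `Γ_α ⊆ ℚ` of `ℚ_p(α) ⊆ ℂ_p`. -/
def valSetCp (α : S.Cp) : Set ℚ :=
  {γ : ℚ | ∃ x : S.Cp, InQpAlpha p S α x ∧ S.vC.v x = (γ : WithTop ℚ)}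

/-- The residue field `k_α` of `O_{p,α} = O_p ∩ ℚ_p(α)` is finite. -/
def ResFieldFiniteCp (α : S.Cp) : Prop :=
  ∃ T : Finset S.Cp, ∀ x : S.Cp, InQpAlpha p S α x → 0 ≤ S.vC.v x →
    ∃ a ∈ T, 0 < S.vC.v (x - a)

/-- `α` and `β` are conjugate over `ℚ_p`: some element of `Gal(Q̄_p/ℚ_p)`, extended to its
unique continuous (equivalently, isometric) automorphism of `ℂ_p`, maps `α` to `β`. -/
def ConjCp (α β : S.Cp) : Prop :=
  ∃ σ : S.Cp →+* S.Cp, (∀ c : ℚ_[p], σ (qpHomC p S c) = qpHomC p S c) ∧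
    (∀ x : Qpbar p, ∃ y : Qpbar p, σ (S.emb x) = S.emb y) ∧
    (∀ x : S.Cp, S.vC.v (σ x) = S.vC.v x) ∧ σ α = β

end CpDefs

namespace AddValuation

variable {K : Type*} [Field K] (v : AddValuation K (WithTop ℚ))

theorem lt_mul_sub_mul {x x' y y' : K} (h : v y < v (x - y)) (h' : v y' < v (x' - y')) :
    v (y * y') < v (x * x' - y * y') := by
  have e : x * x' - y * y' = (x - y) * x' + y * (x' - y') := by ring
  rw [e, map_mul]
  apply map_lt_add
  · rw [map_mul, map_eq_of_lt_sub v h']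
    exact WithTop.add_lt_add_right h'.ne_top h
  · rw [map_mul]
    exact WithTop.add_lt_add_left h.ne_top h'

theorem lt_prod_sub_prod {a b : K} (R : Multiset K) (h : ∀ r ∈ R, v (b - r) < v (a - b)) :
    v (R.map (b - ·)).prod < v ((R.map (a - ·)).prod - (R.map (b - ·)).prod) := by
  induction R using Multiset.induction_on with
  | empty => simp
  | cons r R ih =>
    simp only [Multiset.map_cons, Multiset.prod_cons]
    refine lt_mul_sub_mul v ?_ (ih fun r hr => h r (Multiset.mem_cons_of_mem hr))
    simpa using h r (Multiset.mem_cons_self r R)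

theorem map_multiset_prod (R : Multiset K) : v R.prod = (R.map v).sum := by
  induction R using Multiset.induction_on with
  | empty => simp
  | cons r R ih => simp [ih]

variable {F : Type*} [Field F] [Algebra F K] [IsAlgClosed K]

theorem lt_aeval_sub_aeval {f : F[X]} (hf : f ≠ 0) {a b : K}
    (h : ∀ r ∈ f.aroots K, v (b - r) < v (a - b)) :
    v (aeval b f) < v (aeval a f - aeval b f) := by
  have hs : (f.map (algebraMap F K)).Splits := IsAlgClosed.splits _
  rw [hs.aeval_eq_prod_aroots, hs.aeval_eq_prod_aroots]
  refine lt_mul_sub_mul v ?_ (lt_prod_sub_prod v _ h)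
  simpa [WithTop.lt_top_iff_ne_top] using hf

end AddValuation

theorem Multiset.sum_map_lt_sum_map_withTop {α : Type*} (R : Multiset α) {f g : α → WithTop ℚ}
    (h : ∀ r ∈ R, f r ≤ g r) (hf : ∀ r ∈ R, f r ≠ ⊤) {a : α} (ha : a ∈ R) (hlt : f a < g a) :
    (R.map f).sum < (R.map g).sum := by
  obtain ⟨R, rfl⟩ := Multiset.exists_cons_of_mem ha
  simp only [Multiset.map_cons, Multiset.sum_cons]
  have h' : (R.map f).sum ≤ (R.map g).sum :=
    Multiset.sum_map_le_sum_map _ _ fun r hr => h r (Multiset.mem_cons_of_mem hr)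
  have hne : (R.map f).sum ≠ ⊤ := by
    have : ∀ r ∈ R, f r ≠ ⊤ := fun r hr => hf r (Multiset.mem_cons_of_mem hr)
    clear h h' ha hf
    induction R using Multiset.induction_on with
    | empty => simp
    | cons r R ih =>
      simp only [Multiset.map_cons, Multiset.sum_cons]
      exact WithTop.add_ne_top.2 ⟨this r (Multiset.mem_cons_self r R),
        ih fun r hr => this r (Multiset.mem_cons_of_mem hr)⟩
  exact WithTop.add_lt_add_of_lt_of_le hne hlt h'

namespace PadicSetup

variable {p} (S : PadicSetup p)

/-- The valuation of `S` as an `AddValuation`. -/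
def val : AddValuation (Qpbar p) (WithTop ℚ) :=
  AddValuation.of S.vbar.v ((S.vbar.v_eq_top_iff 0).2 rfl)
    (by
      have h := S.vbar_extends 1 one_ne_zero
      simpa using h)
    S.vbar.min_le_v_add S.vbar.v_mul

theorem val_apply (x : Qpbar p) : S.vbar.v x = S.val x := rfl

theorem val_algebraMap {x : ℚ_[p]} (hx : x ≠ 0) :
    S.val (algebraMap ℚ_[p] (Qpbar p) x) = ((x.valuation : ℚ) : WithTop ℚ) :=
  S.vbar_extends x hx

/-- The function `x ↦ p ^ (-v x)`. -/
def absFun (x : Qpbar p) : ℝ :=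
  open Classical in if x = 0 then 0 else (p : ℝ) ^ (-(((S.val x).untopD 0 : ℚ) : ℝ))

theorem exists_val_eq {x : Qpbar p} (hx : x ≠ 0) : ∃ q : ℚ, S.val x = q :=
  ⟨_, (WithTop.coe_untop _ ((AddValuation.ne_top_iff _).2 hx)).symm⟩

theorem absFun_of_val {x : Qpbar p} {q : ℚ} (h : S.val x = q) :
    S.absFun x = (p : ℝ) ^ (-(q : ℝ)) := by
  have : x ≠ 0 := (AddValuation.ne_top_iff S.val).1 (by simp [h])
  simp [absFun, this, h]

theorem absFun_zero : S.absFun 0 = 0 := by simp [absFun]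

theorem absFun_nonneg (x : Qpbar p) : 0 ≤ S.absFun x := by
  unfold absFun
  split_ifs
  · exact le_rfl
  · positivity

/-- The absolute value attached to the valuation of `S`. -/
def absVal : AbsoluteValue (Qpbar p) ℝ where
  toFun := S.absFun
  map_mul' x y := by
    rcases eq_or_ne x 0 with rfl | hx
    · simp [absFun_zero]
    rcases eq_or_ne y 0 with rfl | hy
    · simp [absFun_zero]
    obtain ⟨a, ha⟩ := S.exists_val_eq hx
    obtain ⟨b, hb⟩ := S.exists_val_eq hy
    have hab : S.val (x * y) = ((a + b : ℚ) : WithTop ℚ) := by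
      rw [AddValuation.map_mul, ha, hb]; rfl
    have hp : (0 : ℝ) < p := by exact_mod_cast (Fact.out : p.Prime).pos
    rw [S.absFun_of_val ha, S.absFun_of_val hb, S.absFun_of_val hab, ← Real.rpow_add hp]
    push_cast
    ring_nf
  nonneg' := S.absFun_nonneg
  eq_zero' x := by
    refine ⟨fun h => ?_, fun h => by rw [h, absFun_zero]⟩
    by_contra hx
    have hp : (0 : ℝ) < p := by exact_mod_cast (Fact.out : p.Prime).pos
    simp only [absFun, hx, if_false] at h
    exact (Real.rpow_pos_of_pos hp _).ne' h
  add_le' x y := by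
    have hp : (1 : ℝ) < p := by exact_mod_cast (Fact.out : p.Prime).one_lt
    rcases eq_or_ne x 0 with rfl | hx
    · simp [absFun_zero]
    rcases eq_or_ne y 0 with rfl | hy
    · simp [absFun_zero]
    rcases eq_or_ne (x + y) 0 with hxy | hxy
    · rw [hxy, absFun_zero]
      exact add_nonneg (S.absFun_nonneg x) (S.absFun_nonneg y)
    obtain ⟨a, ha⟩ := S.exists_val_eq hx
    obtain ⟨b, hb⟩ := S.exists_val_eq hy
    obtain ⟨c, hc⟩ := S.exists_val_eq hxy
    have h := S.val.map_add' x y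
    rw [ha, hb, hc, WithTop.coe_le_coe, WithTop.coe_le_coe] at h
    have key : ∀ {u : Qpbar p} {q : ℚ}, S.val u = q → q ≤ c → S.absFun (x + y) ≤ S.absFun u := by
      intro u q hu hq
      rw [S.absFun_of_val hc, S.absFun_of_val hu]
      exact Real.rpow_le_rpow_of_exponent_le hp.le (by exact_mod_cast neg_le_neg hq)
    rcases h with h | h
    · exact (key ha h).trans (le_add_of_nonneg_right (S.absFun_nonneg y))
    · exact (key hb h).trans (le_add_of_nonneg_left (S.absFun_nonneg x))

theorem val_galois (σ : Qpbar p ≃ₐ[ℚ_[p]] Qpbar p) (x : Qpbar p) : S.val (σ x) = S.val x := by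
  rcases eq_or_ne x 0 with rfl | hx
  · simp
  have hp : (1 : ℝ) < p := by exact_mod_cast (Fact.out : p.Prime).one_lt
  have hext : ∀ c : ℚ_[p], S.absVal (algebraMap ℚ_[p] (Qpbar p) c) = ‖c‖ := fun c => by
    rcases eq_or_ne c 0 with rfl | hc
    · simp
    · refine (S.absFun_of_val (S.val_algebraMap hc)).trans ?_
      rw [Padic.norm_eq_zpow_neg_valuation hc, ← Real.rpow_intCast]
      push_cast
      rfl
  have h : S.absFun (σ x) = S.absFun x := by
    have h1 := spectralNorm_unique_field_norm_ext hext (σ x)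
    have h2 := spectralNorm_unique_field_norm_ext hext x
    rw [spectralNorm_eq_of_equiv σ x] at h2
    exact h1.trans h2.symm
  obtain ⟨a, ha⟩ := S.exists_val_eq hx
  obtain ⟨b, hb⟩ := S.exists_val_eq ((map_ne_zero σ).2 hx)
  rw [S.absFun_of_val ha, S.absFun_of_val hb] at h
  have := (Real.rpow_right_inj (by linarith) hp.ne').1 h
  rw [ha, hb]
  have hab : b = a := by exact_mod_cast neg_injective this
  rw [hab]

/-- If `minpoly c` takes values of the same valuation at `a` and `b`, then `b` is at least as close
to some conjugate of `c` as `a` is to `c`. -/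
theorem exists_conj_close {a b c : Qpbar p}
    (h : S.val (aeval a (minpoly ℚ_[p] c)) = S.val (aeval b (minpoly ℚ_[p] c))) :
    ∃ σ : Qpbar p ≃ₐ[ℚ_[p]] Qpbar p, S.val (a - c) ≤ S.val (b - σ c) := by
  have hc : IsIntegral ℚ_[p] c := Algebra.IsIntegral.isIntegral c
  have hmem : ∀ r, r ∈ (minpoly ℚ_[p] c).aroots (Qpbar p) ↔
      ∃ σ : Qpbar p ≃ₐ[ℚ_[p]] Qpbar p, σ c = r := fun r => by
    rw [← isConjRoot_iff_mem_minpoly_aroots hc, IsConjRoot.comm, isConjRoot_iff_exists_algEquiv]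
  classical
  set R := (minpoly ℚ_[p] c).aroots (Qpbar p) with hR
  have hval : ∀ x, S.val (aeval x (minpoly ℚ_[p] c)) = (R.map fun r => S.val (x - r)).sum := by
    intro x
    rw [(IsAlgClosed.splits _).aeval_eq_prod_aroots_of_monic (minpoly.monic hc),
      AddValuation.map_multiset_prod, Multiset.map_map]
    rfl
  by_contra! hlt
  obtain ⟨r₀, hr₀, hmax⟩ := R.toFinset.exists_max_image (fun r => S.val (b - r))
    ⟨c, by rw [Multiset.mem_toFinset, hmem]; exact ⟨1, rfl⟩⟩
  obtain ⟨σ, rfl⟩ := (hmem r₀).1 (Multiset.mem_toFinset.1 hr₀)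
  have hperm : R.map σ = R := by
    have := (IsAlgClosed.splits ((minpoly ℚ_[p] c).map (algebraMap ℚ_[p] (Qpbar p)))).roots_map
      (σ : Qpbar p →+* Qpbar p)
    rw [Polynomial.map_map] at this
    refine this.symm.trans ?_
    rw [hR, aroots_def]
    congr 2
    ext x
    simp
  have hmax' : ∀ r ∈ R, S.val (b - σ r) ≤ S.val (b - σ c) := fun r hr =>
    hmax _ (Multiset.mem_toFinset.2 (hperm ▸ Multiset.mem_map_of_mem σ hr))
  refine h.symm.not_lt ?_
  rw [hval, hval]
  conv_lhs => rw [← hperm, Multiset.map_map]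
  refine Multiset.sum_map_lt_sum_map_withTop R (a := c) (fun r hr => ?_) (fun r hr => ?_) ?_ ?_
  · have h1 : S.val (b - σ r) ≤ S.val (c - r) := by
      rw [← S.val_galois σ (c - r), _root_.map_sub σ, ← sub_sub_sub_cancel_left (σ r) (σ c) b]
      exact S.val.map_le_sub le_rfl (hmax' r hr)
    have h2 := S.val.map_le_add ((hmax' r hr).trans (hlt σ).le) h1
    simpa using h2
  · exact ((hmax' r hr).trans_lt (hlt σ)).ne_top
  · exact (hmem c).2 ⟨1, rfl⟩
  · exact hlt σ

end PadicSetup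

section Sequences

variable {p} {S : PadicSetup p} {s t : ℕ → Qpbar p}

theorem degOf_eq_natDegree_minpoly (x : Qpbar p) : degOf p x = (minpoly ℚ_[p] x).natDegree :=
  IntermediateField.adjoin.finrank (Algebra.IsIntegral.isIntegral x)

theorem degOf_galois (σ : Qpbar p ≃ₐ[ℚ_[p]] Qpbar p) (x : Qpbar p) :
    degOf p (σ x) = degOf p x := by
  rw [degOf_eq_natDegree_minpoly, degOf_eq_natDegree_minpoly, minpoly.algEquiv_eq]

theorem degOf_le_natDegree {f : ℚ_[p][X]} {r : Qpbar p} (hr : r ∈ f.aroots (Qpbar p)) :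
    degOf p r ≤ f.natDegree := by
  rw [mem_aroots] at hr
  rw [degOf_eq_natDegree_minpoly]
  exact natDegree_le_of_dvd (minpoly.dvd _ _ hr.2) hr.1

theorem exists_aeval_of_mem_adjoin {x a : Qpbar p} (ha : a ∈ IntermediateField.adjoin ℚ_[p] {x}) :
    ∃ f : ℚ_[p][X], f.natDegree < degOf p x ∧ aeval x f = a := by
  have hx : IsIntegral ℚ_[p] x := Algebra.IsIntegral.isIntegral x
  obtain ⟨f, rfl⟩ : ∃ f : ℚ_[p][X], aeval x f = a := by
    rw [← IntermediateField.mem_toSubalgebra,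
      IntermediateField.adjoin_simple_toSubalgebra_of_isAlgebraic hx.isAlgebraic,
      Algebra.adjoin_singleton_eq_range_aeval] at ha
    exact ha
  refine ⟨f %ₘ minpoly ℚ_[p] x, ?_, aeval_modByMonic_eq_self_of_root (minpoly.aeval _ _)⟩
  rw [degOf_eq_natDegree_minpoly]
  exact natDegree_modByMonic_lt _ (minpoly.monic hx) (minpoly.ne_one _ _)

theorem aeval_mem_adjoin (x : Qpbar p) (f : ℚ_[p][X]) :
    aeval x f ∈ IntermediateField.adjoin ℚ_[p] {x} :=
  IntermediateField.algebra_adjoin_le_adjoin _ _ (aeval_mem_adjoin_singleton _ x)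

namespace IsStacked

theorem gauge_lt_succ (hs : IsStacked p S s) (n : ℕ) :
    S.val (s (n + 1) - s n) < S.val (s (n + 2) - s (n + 1)) :=
  hs.min_pair (n + 1) (s n) (hs.deg_lt n)

theorem strictMono_gauge (hs : IsStacked p S s) :
    StrictMono fun n => S.val (s (n + 1) - s n) :=
  strictMono_nat_of_lt_succ hs.gauge_lt_succ

theorem strictMono_degOf (hs : IsStacked p S s) : StrictMono fun n => degOf p (s n) :=
  strictMono_nat_of_lt_succ hs.deg_lt

theorem val_sub_eq (hs : IsStacked p S s) {n m : ℕ} (h : n < m) :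
    S.val (s m - s n) = S.val (s (n + 1) - s n) := by
  induction m, h using Nat.le_induction with
  | base => rfl
  | succ m hm ih =>
    rw [← sub_add_sub_cancel (s (m + 1)) (s m) (s n), S.val.map_add_eq_of_lt_right, ih]
    rw [ih]
    exact hs.strictMono_gauge (Nat.lt_of_succ_le hm)

theorem lt_aeval_sub_aeval (hs : IsStacked p S s) {f : ℚ_[p][X]} (hf : f ≠ 0) {n m : ℕ}
    (hn : f.natDegree < degOf p (s n)) (h : n ≤ m) :
    S.val (aeval (s n) f) < S.val (aeval (s m) f - aeval (s n) f) := by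
  refine S.val.lt_aeval_sub_aeval hf fun r hr => ?_
  have hr' := hs.min_pair n r ((degOf_le_natDegree hr).trans_lt hn)
  rw [S.val_apply, S.val_apply] at hr'
  rcases h.eq_or_lt with rfl | h
  · rw [sub_self, AddValuation.map_zero]
    exact hr'.trans_le le_top
  · rwa [hs.val_sub_eq h]

theorem val_aeval_eq (hs : IsStacked p S s) {f : ℚ_[p][X]} {n m : ℕ}
    (hn : f.natDegree < degOf p (s n)) (h : n ≤ m) :
    S.val (aeval (s m) f) = S.val (aeval (s n) f) := by
  rcases eq_or_ne f 0 with rfl | hf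
  · simp
  · exact S.val.map_eq_of_lt_sub (hs.lt_aeval_sub_aeval hf hn h)

theorem eventually_natDegree_lt (hs : IsStacked p S s) (f : ℚ_[p][X]) :
    ∀ᶠ n in atTop, f.natDegree < degOf p (s n) :=
  hs.strictMono_degOf.tendsto_atTop.eventually_gt_atTop _

theorem aeval_ne_zero (hs : IsStacked p S s) {f : ℚ_[p][X]} (hf : f ≠ 0) {n : ℕ}
    (hn : f.natDegree < degOf p (s n)) : aeval (s n) f ≠ 0 := by
  rw [← AddValuation.ne_top_iff S.val]
  exact (hs.lt_aeval_sub_aeval hf hn le_rfl).ne_top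

/-- The valuations of a nonzero polynomial along a stacked sequence are eventually a constant
rational number. -/
theorem eventually_val_aeval (hs : IsStacked p S s) {f : ℚ_[p][X]} (hf : f ≠ 0) :
    ∃ q : ℚ, ∀ᶠ n in atTop, S.val (aeval (s n) f) = q := by
  obtain ⟨n, hn⟩ := (hs.eventually_natDegree_lt f).exists
  obtain ⟨q, hq⟩ := S.exists_val_eq (hs.aeval_ne_zero hf hn)
  refine ⟨q, ?_⟩
  filter_upwards [eventually_ge_atTop n] with m hm
  rw [hs.val_aeval_eq hn hm, hq]

end IsStacked

theorem algebraMap_mem_ZpE_iff (f : ℚ_[p][X]) :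
    algebraMap ℚ_[p][X] (RatFunc ℚ_[p]) f ∈ ZpE p S s ↔
      ∀ᶠ n in atTop, 0 ≤ S.val (aeval (s n) f) := by
  simp [ZpE, S.val_apply, aeval_def]

theorem inv_algebraMap_mem_ZpE {f : ℚ_[p][X]} (h : ∀ᶠ n in atTop, S.val (aeval (s n) f) = 0) :
    (algebraMap ℚ_[p][X] (RatFunc ℚ_[p]) f)⁻¹ ∈ ZpE p S s := by
  filter_upwards [h] with n hn
  have hne : eval₂ (algebraMap ℚ_[p] (Qpbar p)) (s n) f ≠ 0 :=
    (AddValuation.ne_top_iff S.val).1 (by rw [← aeval_def, hn]; simp)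
  have hf : f ≠ 0 := by
    rintro rfl
    simp at hne
  have hden : eval₂ (algebraMap ℚ_[p] (Qpbar p)) (s n)
      (algebraMap ℚ_[p][X] (RatFunc ℚ_[p]) f)⁻¹.denom ≠ 0 := fun h0 => hne <| by
    have hdvd := RatFunc.denom_div_dvd 1 f
    rw [map_one, one_div] at hdvd
    exact eval₂_eq_zero_of_dvd_of_eval₂_eq_zero _ _ hdvd h0
  refine ⟨hden, ?_⟩
  have hmul := RatFunc.eval_mul (f := algebraMap ℚ_[p] (Qpbar p)) (a := s n)
    (x := algebraMap ℚ_[p][X] (RatFunc ℚ_[p]) f) (by simp) hden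
  rw [mul_inv_cancel₀ (by simpa using hf), RatFunc.eval_one, RatFunc.eval_algebraMap] at hmul
  have hv := congrArg S.val hmul
  rw [AddValuation.map_one, AddValuation.map_mul,
    Algebra.algebraMap_self_apply, ← aeval_def, hn, zero_add] at hv
  exact hv.le

theorem le_of_ZpE_subset (h : ZpE p S s ⊆ ZpE p S t)
    {f : ℚ_[p][X]} {a b : ℚ} (ha : ∀ᶠ n in atTop, S.val (aeval (s n) f) = a)
    (hb : ∀ᶠ n in atTop, S.val (aeval (t n) f) = b) : a ≤ b := by
  by_contra! hlt
  obtain ⟨k, hk⟩ := exists_nat_gt (1 / (a - b))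
  have hk' : 1 < k * (a - b) := by
    rwa [div_lt_iff₀ (sub_pos.2 hlt)] at hk
  set j : ℤ := ⌊k * a⌋ with hj
  have hja : (j : ℚ) ≤ k * a := Int.floor_le _
  have hjb : k * b < j := by linarith [Int.lt_floor_add_one (k * a : ℚ)]
  have hp0 : (p : ℚ_[p]) ≠ 0 := by exact_mod_cast (Fact.out : p.Prime).ne_zero
  have hval : ∀ (x : Qpbar p) (q : ℚ), S.val (aeval x f) = q →
      S.val (aeval x (C ((p : ℚ_[p]) ^ (-j)) * f ^ k)) = ((k * q - j : ℚ) : WithTop ℚ) := by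
    intro x q hq
    rw [map_mul, aeval_C, map_pow, AddValuation.map_mul, AddValuation.map_pow, hq,
      S.val_algebraMap (zpow_ne_zero _ hp0), ← WithTop.coe_nsmul, ← WithTop.coe_add]
    simp [Padic.valuation_zpow, sub_eq_neg_add]
  have hmem := h ((algebraMap_mem_ZpE_iff (C ((p : ℚ_[p]) ^ (-j)) * f ^ k)).2 (by
    filter_upwards [ha] with n hn
    rw [hval _ _ hn]
    exact_mod_cast sub_nonneg.2 hja))
  obtain ⟨n, hn, hn'⟩ := (((algebraMap_mem_ZpE_iff _).1 hmem).and hb).exists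
  rw [hval _ _ hn'] at hn
  have : (0 : ℚ) ≤ k * b - j := by exact_mod_cast hn
  linarith

theorem eventually_val_aeval_eq (hs : IsStacked p S s) (ht : IsStacked p S t)
    (h : ZpE p S s = ZpE p S t) (f : ℚ_[p][X]) :
    ∀ᶠ n in atTop, S.val (aeval (s n) f) = S.val (aeval (t n) f) := by
  rcases eq_or_ne f 0 with rfl | hf
  · simp
  obtain ⟨a, ha⟩ := hs.eventually_val_aeval hf
  obtain ⟨b, hb⟩ := ht.eventually_val_aeval hf
  have hab : a = b :=
    (le_of_ZpE_subset h.subset ha hb).antisymm (le_of_ZpE_subset h.superset hb ha)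
  filter_upwards [ha, hb] with n hn hn'
  rw [hn, hn', hab]

/-- If `s k` has degree smaller than `t (n + 1)`, then the `k`-th gauge of `s` is at most the
`n`-th gauge of `t`. -/
theorem gauge_le_of_degOf_lt (hs : IsStacked p S s) (ht : IsStronglyStacked p S t)
    (h : ZpE p S s = ZpE p S t) {k n : ℕ} (hdeg : degOf p (s k) < degOf p (t (n + 1))) :
    S.val (s (k + 1) - s k) ≤ S.val (t (n + 1) - t n) := by
  obtain ⟨m, hm, hkm, hnm⟩ := ((eventually_val_aeval_eq hs ht.toIsStacked h
    (minpoly ℚ_[p] (s k))).and ((eventually_gt_atTop k).and (eventually_gt_atTop (n + 1)))).exists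
  obtain ⟨σ, hσ⟩ := S.exists_conj_close hm
  rw [hs.val_sub_eq hkm] at hσ
  by_contra! hlt
  have hdist := ht.dist n (σ (s k)) (by rwa [degOf_galois])
  rw [S.val_apply, S.val_apply] at hdist
  refine hdist.not_gt ?_
  rw [← sub_sub_sub_cancel_left (σ (s k)) (t (n + 1)) (t m)]
  have h1 : S.val (t (n + 1) - t n) < S.val (t m - t (n + 1)) := by
    rw [ht.toIsStacked.val_sub_eq hnm]
    exact ht.toIsStacked.gauge_lt_succ n
  rw [sub_eq_add_neg (t m - σ (s k))]
  exact S.val.map_lt_add (hlt.trans_le hσ) (by rwa [AddValuation.map_neg])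

theorem degOf_first (hs : IsStacked p S s) : degOf p (s 0) = 1 := by
  obtain ⟨c, hc⟩ := hs.first
  rw [degOf_eq_natDegree_minpoly, hc, minpoly.eq_X_sub_C, natDegree_X_sub_C]

theorem gauge_eq_of_degOf_eq (hs : IsStronglyStacked p S s) (ht : IsStronglyStacked p S t)
    (h : ZpE p S s = ZpE p S t) {n : ℕ} (hdeg : degOf p (s n) = degOf p (t n)) :
    S.val (s (n + 1) - s n) = S.val (t (n + 1) - t n) :=
  (gauge_le_of_degOf_lt hs.toIsStacked ht h (hdeg ▸ ht.deg_lt n)).antisymm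
    (gauge_le_of_degOf_lt ht.toIsStacked hs h.symm (hdeg ▸ hs.deg_lt n))

theorem degOf_succ_le (hs : IsStronglyStacked p S s) (ht : IsStronglyStacked p S t)
    (h : ZpE p S s = ZpE p S t) {n : ℕ} (hdeg : degOf p (s n) = degOf p (t n)) :
    degOf p (t (n + 1)) ≤ degOf p (s (n + 1)) := by
  by_contra! hlt
  have h1 := gauge_le_of_degOf_lt hs.toIsStacked ht h hlt
  rw [← gauge_eq_of_degOf_eq hs ht h hdeg] at h1
  exact h1.not_gt (hs.toIsStacked.gauge_lt_succ n)

theorem degOf_eq (hs : IsStronglyStacked p S s) (ht : IsStronglyStacked p S t)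
    (h : ZpE p S s = ZpE p S t) (n : ℕ) : degOf p (s n) = degOf p (t n) := by
  induction n with
  | zero => rw [degOf_first hs.toIsStacked, degOf_first ht.toIsStacked]
  | succ n ih =>
    exact (degOf_succ_le ht hs h.symm ih.symm).antisymm (degOf_succ_le hs ht h ih)

theorem val_aeval_eq_of_degOf_eq (hs : IsStacked p S s) (ht : IsStacked p S t)
    (h : ZpE p S s = ZpE p S t) {n : ℕ} (hdeg : degOf p (s n) = degOf p (t n)) {f : ℚ_[p][X]}
    (hf : f.natDegree < degOf p (s n)) : S.val (aeval (s n) f) = S.val (aeval (t n) f) := by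
  obtain ⟨m, hm, hnm⟩ := ((eventually_val_aeval_eq hs ht h f).and (eventually_ge_atTop n)).exists
  rw [← hs.val_aeval_eq hf hnm, hm, ht.val_aeval_eq (hdeg ▸ hf) hnm]

theorem valSetElem_subset (hs : IsStacked p S s) (ht : IsStacked p S t)
    (h : ZpE p S s = ZpE p S t) {n : ℕ} (hdeg : degOf p (s n) = degOf p (t n)) :
    valSetElem p S (s n) ⊆ valSetElem p S (t n) := by
  rintro γ ⟨a, ha, hγ⟩
  obtain ⟨f, hf, rfl⟩ := exists_aeval_of_mem_adjoin ha
  exact ⟨aeval (t n) f, aeval_mem_adjoin _ f,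
    (val_aeval_eq_of_degOf_eq hs ht h hdeg hf).symm.trans hγ⟩

end Sequences

/-- A root of the minimal polynomial of an element `β` of a finite field is a polynomial in `β`. -/
theorem exists_aeval_eq_of_aeval_minpoly_eq_zero {q : ℕ} [Fact q.Prime] {k : Type*} [Field k]
    [Algebra (ZMod q) k] {α β : k} {n : ℕ} (hn : 1 ≤ n) (hβ : β ^ q ^ n = β)
    (hα : aeval α (minpoly (ZMod q) β) = 0) : ∃ g : (ZMod q)[X], aeval β g = α := by
  have hq : 1 < q ^ n := Nat.one_lt_pow (by omega) (Fact.out : q.Prime).one_lt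
  have hint : IsIntegral (ZMod q) β :=
    ⟨X ^ q ^ n - X, monic_X_pow_sub (degree_X_le.trans_lt (by exact_mod_cast hq)), by simp [hβ]⟩
  let L := IntermediateField.adjoin (ZMod q) {β}
  have : FiniteDimensional (ZMod q) L := IntermediateField.adjoin.finiteDimensional hint
  have : Finite L := Module.finite_of_finite (ZMod q)
  have hsplit := Normal.splits (inferInstance : Normal (ZMod q) L)
    (IntermediateField.AdjoinSimple.gen (ZMod q) β)
  rw [IntermediateField.minpoly_gen] at hsplit
  obtain ⟨x, hx⟩ := hsplit.mem_range_of_isRoot (i := algebraMap L k) (x := α)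
    ((Polynomial.map_ne_zero_iff (algebraMap (ZMod q) L).injective).2 (minpoly.ne_zero hint)) (by
      rw [Polynomial.map_map, ← IsScalarTower.algebraMap_eq, IsRoot, eval_map_algebraMap, hα])
  have hmem : α ∈ L := hx ▸ x.2
  rw [← IntermediateField.mem_toSubalgebra,
    IntermediateField.adjoin_simple_toSubalgebra_of_isAlgebraic hint.isAlgebraic,
    Algebra.adjoin_singleton_eq_range_aeval] at hmem
  exact hmem

namespace PadicSetup

variable {p} (S : PadicSetup p)

/-- The valuation ring of `S`. -/
def integers : ValuationSubring (Qpbar p) where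
  carrier := {x | 0 ≤ S.val x}
  mul_mem' {x y} hx hy := by
    change 0 ≤ S.val (x * y)
    rw [AddValuation.map_mul]
    exact add_nonneg hx hy
  one_mem' := S.val.map_one.ge
  add_mem' hx hy := S.val.map_le_add hx hy
  zero_mem' := by simp
  neg_mem' {x} hx := by
    change 0 ≤ S.val (-x)
    rwa [AddValuation.map_neg]
  mem_or_inv_mem' x := by
    rcases eq_or_ne x 0 with rfl | hx
    · simp
    obtain ⟨a, ha⟩ := S.exists_val_eq hx
    obtain ⟨b, hb⟩ := S.exists_val_eq (inv_ne_zero hx)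
    have h := S.val.map_mul x x⁻¹
    rw [mul_inv_cancel₀ hx, AddValuation.map_one, ha, hb] at h
    change 0 ≤ S.val x ∨ 0 ≤ S.val x⁻¹
    rw [ha, hb]
    have h' : (0 : ℚ) = a + b := by exact_mod_cast h
    rcases le_total 0 a with h0 | h0
    · exact Or.inl (by exact_mod_cast h0)
    · exact Or.inr (by exact_mod_cast (by linarith : (0 : ℚ) ≤ b))

theorem mem_integers_iff {x : Qpbar p} : x ∈ S.integers ↔ 0 ≤ S.val x := Iff.rfl

theorem residue_eq_zero_iff (x : S.integers) :
    IsLocalRing.residue S.integers x = 0 ↔ 0 < S.val x := by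
  rw [IsLocalRing.residue_eq_zero_iff, IsLocalRing.mem_maximalIdeal, mem_nonunits_iff]
  refine ⟨fun h => ?_, fun h hu => ?_⟩
  · refine lt_of_le_of_ne x.2 fun h0 => h ?_
    have hx : (x : Qpbar p) ≠ 0 := (AddValuation.ne_top_iff S.val).1 (by rw [← h0]; simp)
    have hv := S.val.map_mul (x : Qpbar p) (x : Qpbar p)⁻¹
    rw [mul_inv_cancel₀ hx, AddValuation.map_one, ← h0, zero_add] at hv
    exact IsUnit.of_mul_eq_one ⟨(x : Qpbar p)⁻¹, hv.le⟩ (Subtype.ext (mul_inv_cancel₀ hx))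
  · obtain ⟨y, hy⟩ := hu.exists_right_inv
    have hv := congrArg (fun z : S.integers => S.val z) hy
    simp only [MulMemClass.coe_mul, OneMemClass.coe_one, AddValuation.map_mul,
      AddValuation.map_one] at hv
    have hpos : 0 < S.val x + S.val y := add_pos_of_pos_of_nonneg h y.2
    exact hpos.ne' hv

theorem residue_eq_residue_iff (x y : S.integers) :
    IsLocalRing.residue S.integers x = IsLocalRing.residue S.integers y ↔
      0 < S.val ((x : Qpbar p) - y) := by
  rw [← sub_eq_zero, ← map_sub, residue_eq_zero_iff]
  rfl

instance charP_residueField : CharP (IsLocalRing.ResidueField S.integers) p := by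
  have h : ((p : ℕ) : IsLocalRing.ResidueField S.integers) = 0 := by
    rw [← map_natCast (IsLocalRing.residue S.integers), residue_eq_zero_iff]
    have hp0 : (p : ℚ_[p]) ≠ 0 := by exact_mod_cast (Fact.out : p.Prime).ne_zero
    have hv := S.val_algebraMap hp0
    rw [map_natCast, Padic.valuation_p] at hv
    simp [hv]
  exact (CharP.charP_iff_prime_eq_zero Fact.out).2 h

instance : Algebra (ZMod p) (IsLocalRing.ResidueField S.integers) := ZMod.algebra _ p

theorem aeval_residue (H : ℤ[X]) (x : S.integers) :
    aeval (IsLocalRing.residue S.integers x) (H.map (Int.castRingHom (ZMod p))) =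
      IsLocalRing.residue S.integers (aeval x H) := by
  rw [aeval_def, eval₂_map, aeval_def, hom_eval₂]
  congr 1
  exact RingHom.ext_int _ _

end PadicSetup

section Residue

variable {p} {S : PadicSetup p} {s t : ℕ → Qpbar p}

theorem IsStacked.val_sub_pos (hs : IsStacked p S s) {f : ℚ_[p][X]} {n m : ℕ}
    (hn : f.natDegree < degOf p (s n)) (h : n ≤ m) (h0 : 0 ≤ S.val (aeval (s n) f)) :
    0 < S.val (aeval (s m) f - aeval (s n) f) := by
  rcases eq_or_ne f 0 with rfl | hf
  · simp
  · exact h0.trans_lt (hs.lt_aeval_sub_aeval hf hn h)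

/-- An integer polynomial annihilating the residue of `f (t n)` annihilates that of `f (s n)`. -/
theorem residue_aeval_eq_zero (hs : IsStacked p S s) (ht : IsStacked p S t)
    (h : ZpE p S s = ZpE p S t) {n : ℕ} {f : ℚ_[p][X]} (hfs : f.natDegree < degOf p (s n))
    (hft : f.natDegree < degOf p (t n)) (hs0 : aeval (s n) f ∈ S.integers)
    (ht0 : aeval (t n) f ∈ S.integers) {H : ℤ[X]}
    (hH : IsLocalRing.residue S.integers (aeval (⟨_, ht0⟩ : S.integers) H) = 0) :
    IsLocalRing.residue S.integers (aeval (⟨_, hs0⟩ : S.integers) H) = 0 := by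
  obtain ⟨m, hm, hnm⟩ := ((eventually_val_aeval_eq hs ht h (aeval f H)).and
    (eventually_ge_atTop n)).exists
  have hval : ∀ {r : ℕ → Qpbar p} (_ : IsStacked p S r) (_ : f.natDegree < degOf p (r n))
      (h0 : aeval (r n) f ∈ S.integers),
      IsLocalRing.residue S.integers (aeval (⟨_, h0⟩ : S.integers) H) = 0 ↔
        0 < S.val (aeval (r m) (aeval f H)) := by
    intro r hr hd h0
    have hm0 : aeval (r m) f ∈ S.integers := by
      rw [S.mem_integers_iff, hr.val_aeval_eq hd hnm]
      exact h0
    have he : IsLocalRing.residue S.integers ⟨_, h0⟩ = IsLocalRing.residue S.integers ⟨_, hm0⟩ :=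
      ((S.residue_eq_residue_iff _ _).2 (hr.val_sub_pos hd hnm h0)).symm
    rw [← S.aeval_residue, he, S.aeval_residue, S.residue_eq_zero_iff]
    have h1 : ((aeval (⟨_, hm0⟩ : S.integers) H : S.integers) : Qpbar p) =
        aeval (aeval (r m) f) H :=
      (aeval_algHom_apply S.integers.subtype.toIntAlgHom _ H).symm
    have h2 : aeval (r m) (aeval f H) = aeval (aeval (r m) f) H :=
      (aeval_algHom_apply ((aeval (r m) : ℚ_[p][X] →ₐ[ℚ_[p]] Qpbar p).restrictScalars ℤ) f H).symm
    rw [h1, h2]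
  rw [hval hs hfs]
  rw [hval ht hft] at hH
  rwa [hm]

theorem exists_residue_pow_eq (ht : IsStacked p S t) {W : ValuationSubring (RatFunc ℚ_[p])}
    (hW : IsResAlgTorsionQp p W) (hWt : (W : Set (RatFunc ℚ_[p])) = ZpE p S t) {n : ℕ}
    {f : ℚ_[p][X]} (hf : f.natDegree < degOf p (t n)) (h0 : aeval (t n) f ∈ S.integers) :
    ∃ k : ℕ, 1 ≤ k ∧ IsLocalRing.residue S.integers ⟨_, h0⟩ ^ p ^ k =
      IsLocalRing.residue S.integers ⟨_, h0⟩ := by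
  have hmem : ∀ m ≥ n, aeval (t m) f ∈ S.integers := fun m hm => by
    rw [S.mem_integers_iff, ht.val_aeval_eq hf hm]
    exact h0
  have hfW : algebraMap ℚ_[p][X] (RatFunc ℚ_[p]) f ∈ W := by
    rw [← SetLike.mem_coe, hWt, algebraMap_mem_ZpE_iff]
    filter_upwards [eventually_ge_atTop n] with m hm using hmem m hm
  obtain ⟨k, hk, hpow⟩ := hW.2.1 (IsLocalRing.residue W ⟨_, hfW⟩)
  refine ⟨k, hk, ?_⟩
  rw [← map_pow, ← sub_eq_zero, ← map_sub, IsLocalRing.residue_eq_zero_iff,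
    IsLocalRing.mem_maximalIdeal, mem_nonunits_iff] at hpow
  by_contra hne
  refine hpow ?_
  have hval : ∀ᶠ m in atTop, S.val (aeval (t m) (f ^ p ^ k - f)) = 0 := by
    filter_upwards [eventually_ge_atTop n] with m hm
    have he : IsLocalRing.residue S.integers ⟨_, h0⟩ =
        IsLocalRing.residue S.integers ⟨_, hmem m hm⟩ :=
      ((S.residue_eq_residue_iff _ _).2 (ht.val_sub_pos hf hm h0)).symm
    rw [he, ← map_pow, S.residue_eq_residue_iff] at hne
    refine le_antisymm ?_ ?_
    · simpa using hne
    · rw [map_sub, map_pow]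
      exact sub_mem (pow_mem (hmem m hm) _) (hmem m hm)
  have hinv : (algebraMap ℚ_[p][X] (RatFunc ℚ_[p]) (f ^ p ^ k - f))⁻¹ ∈ W := by
    rw [← SetLike.mem_coe, hWt]
    exact inv_algebraMap_mem_ZpE hval
  have hg : f ^ p ^ k - f ≠ 0 := by
    intro h
    obtain ⟨m, hm⟩ := hval.exists
    simp [h] at hm
  refine IsUnit.of_mul_eq_one ⟨_, hinv⟩ (Subtype.ext ?_)
  change (algebraMap ℚ_[p][X] (RatFunc ℚ_[p]) f ^ p ^ k - algebraMap ℚ_[p][X] (RatFunc ℚ_[p]) f) *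
    (algebraMap ℚ_[p][X] (RatFunc ℚ_[p]) (f ^ p ^ k - f))⁻¹ = 1
  rw [← map_pow, ← map_sub]
  exact mul_inv_cancel₀ (RatFunc.algebraMap_ne_zero hg)

theorem resSub_adjoin (hs : IsStacked p S s) (ht : IsStacked p S t)
    {W : ValuationSubring (RatFunc ℚ_[p])} (hW : IsResAlgTorsionQp p W)
    (hWs : (W : Set (RatFunc ℚ_[p])) = ZpE p S s) (hWt : (W : Set (RatFunc ℚ_[p])) = ZpE p S t)
    {n : ℕ} (hdeg : degOf p (s n) = degOf p (t n)) :
    resSub p S (IntermediateField.adjoin ℚ_[p] {s n})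
      (IntermediateField.adjoin ℚ_[p] {t n}) := by
  intro a ha ha0
  obtain ⟨f, hfs, rfl⟩ := exists_aeval_of_mem_adjoin ha
  have hft : f.natDegree < degOf p (t n) := hdeg ▸ hfs
  have hst : ZpE p S s = ZpE p S t := hWs.symm.trans hWt
  have hs0 : aeval (s n) f ∈ S.integers := ha0
  have ht0 : aeval (t n) f ∈ S.integers := by
    rw [S.mem_integers_iff, ← val_aeval_eq_of_degOf_eq hs ht hst hdeg hfs]
    exact hs0
  obtain ⟨k, hk, hpow⟩ := exists_residue_pow_eq ht hW hWt hft ht0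
  obtain ⟨H, hH⟩ := map_surjective (Int.castRingHom (ZMod p)) ZMod.intCast_surjective
    (minpoly (ZMod p) (IsLocalRing.residue S.integers ⟨_, ht0⟩))
  obtain ⟨g, hg⟩ := exists_aeval_eq_of_aeval_minpoly_eq_zero hk hpow
    (α := IsLocalRing.residue S.integers ⟨_, hs0⟩) (by
      rw [← hH, S.aeval_residue]
      refine residue_aeval_eq_zero hs ht hst hfs hft hs0 ht0 ?_
      rw [← S.aeval_residue, hH, minpoly.aeval])
  obtain ⟨G, rfl⟩ := map_surjective (Int.castRingHom (ZMod p)) ZMod.intCast_surjective g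
  rw [S.aeval_residue, eq_comm, S.residue_eq_residue_iff] at hg
  refine ⟨(aeval (⟨_, ht0⟩ : S.integers) G : S.integers), ?_,
    (aeval (⟨_, ht0⟩ : S.integers) G).2, hg⟩
  have h1 : ((aeval (⟨_, ht0⟩ : S.integers) G : S.integers) : Qpbar p) =
      aeval (aeval (t n) f) G :=
    (aeval_algHom_apply S.integers.subtype.toIntAlgHom _ G).symm
  have h2 : aeval (t n) (aeval f G) = aeval (aeval (t n) f) G :=
    (aeval_algHom_apply ((aeval (t n) : ℚ_[p][X] →ₐ[ℚ_[p]] Qpbar p).restrictScalars ℤ) f G).symm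
  rw [h1, ← h2]
  exact aeval_mem_adjoin _ _

end Residue

/-- Let `W ⊆ ℚ_p(X)` be a residually algebraic torsion extension of `ℤ_p`
and let `E = {s_n}`, `E' = {t_n}` be strongly stacked sequences in `Q̄_p` with
`W = ℤ_{p,E} = ℤ_{p,E'}`.  Then for every `n`: (i) `[ℚ_p(s_n):ℚ_p] = [ℚ_p(t_n):ℚ_p]` and the
gauges agree, `δ_n = v_p(s_{n+1} - s_n) = v_p(t_{n+1} - t_n) = δ'_n`; (ii) the ramification
index and the residue degree of `ℚ_p(s_n)/ℚ_p` equal those of `ℚ_p(t_n)/ℚ_p` (equivalently,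
`ℚ_p(s_n)` and `ℚ_p(t_n)` have the same value group and the same residue field). -/
theorem stmt_6 (p : ℕ) [Fact p.Prime] (S : PadicSetup p) (s t : ℕ → Qpbar p)
    (hs : IsStronglyStacked p S s) (ht : IsStronglyStacked p S t)
    (W : ValuationSubring (RatFunc ℚ_[p])) (hW : IsResAlgTorsionQp p W)
    (hWs : (W : Set (RatFunc ℚ_[p])) = ZpE p S s)
    (hWt : (W : Set (RatFunc ℚ_[p])) = ZpE p S t) :
    ∀ n : ℕ,
      degOf p (s n) = degOf p (t n) ∧
      S.vbar.v (s (n + 1) - s n) = S.vbar.v (t (n + 1) - t n) ∧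
      valSetElem p S (s n) = valSetElem p S (t n) ∧
      resSub p S (IntermediateField.adjoin ℚ_[p] {s n})
        (IntermediateField.adjoin ℚ_[p] {t n}) ∧
      resSub p S (IntermediateField.adjoin ℚ_[p] {t n})
        (IntermediateField.adjoin ℚ_[p] {s n}) := by
  intro n
  have hst : ZpE p S s = ZpE p S t := hWs.symm.trans hWt
  have hdeg := degOf_eq hs ht hst n
  exact ⟨hdeg, gauge_eq_of_degOf_eq hs ht hst hdeg,
    (valSetElem_subset hs.toIsStacked ht.toIsStacked hst hdeg).antisymm
      (valSetElem_subset ht.toIsStacked hs.toIsStacked hst.symm hdeg.symm),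
    resSub_adjoin hs.toIsStacked ht.toIsStacked hW hWs hWt hdeg,
    resSub_adjoin ht.toIsStacked hs.toIsStacked hW hWt hWs hdeg.symm⟩

end
end

section
/- Let t ∈ ℂ_p be of bounded ramification, i.e., the ramification index e_t of ℚ_p(t)/ℚ_p is finite. Then t is the limit in ℂ_p of a sequence contained in the maximal unramified extension of some finite extension of ℚ_p. -/
open Polynomial Filter

noncomputable section

variable (p : ℕ) [Fact p.Prime]

/-- Some binomial coefficient `n.choose q` with `0 < q < n` is prime to `p`, unless `n` is a power
of `p`, in which case `n.choose (n / p)` is exactly divisible by `p`. -/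
theorem exists_choose_almost_unit (p : ℕ) [hp : Fact p.Prime] {n : ℕ} (hn : 1 < n) :
    ∃ q, 0 < q ∧ q < n ∧ (¬ p ∣ n.choose q ∨
      (n = p * q ∧ ∃ m, n.choose q = p * m ∧ ¬ p ∣ m)) := by
  by_cases h : ∀ i ∈ Finset.Icc 1 (n - 1), n.choose i ≡ 0 [MOD p]
  · have hpow := Choose.eq_pow_multiplicity_of_choose_modEq_zero_nat (by omega) h
    obtain ⟨k, hk⟩ : ∃ k, n = p ^ (k + 1) := by
      rcases hm : multiplicity p n with _ | k
      · rw [hm] at hpow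
        simp at hpow
        omega
      · exact ⟨k, by rw [hm] at hpow; exact hpow⟩
    have hp1 := hp.out.one_lt
    have hpk : 0 < p ^ k := Nat.pow_pos hp.out.pos
    have hle : p ^ k < p ^ (k + 1) := Nat.pow_lt_pow_right hp1 (by omega)
    have hfac := Nat.factorization_choose_prime_pow hp.out hle.le hpk.ne'
    rw [Nat.factorization_pow_self hp.out, Nat.add_sub_cancel_left] at hfac
    have h0 : (p ^ (k + 1)).choose (p ^ k) ≠ 0 := (Nat.choose_pos hle.le).ne'
    refine ⟨p ^ k, hpk, hk ▸ hle, Or.inr ⟨by rw [hk]; ring, ?_⟩⟩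
    rw [hk]
    refine ⟨(p ^ (k + 1)).choose (p ^ k) / p, ?_, ?_⟩
    · exact (Nat.mul_div_cancel' (Nat.dvd_of_factorization_pos (by rw [hfac]; decide))).symm
    · have := Nat.not_dvd_ordCompl hp.out h0
      rwa [hfac, pow_one] at this
  · push Not at h
    obtain ⟨q, hq, hqp⟩ := h
    rw [Finset.mem_Icc] at hq
    exact ⟨q, by omega, by omega, Or.inl fun hd => hqp (Nat.modEq_zero_iff_dvd.2 hd)⟩

theorem pow_card_lt_multiset_prod {c : ℝ} (hc : 0 < c) (s : Multiset ℝ) (hs : s ≠ 0)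
    (h : ∀ a ∈ s, c < a) : c ^ s.card < s.prod := by
  induction s using Multiset.induction_on with
  | empty => exact absurd rfl hs
  | cons a s ih =>
    have ha : c < a := h a (Multiset.mem_cons_self a s)
    rw [Multiset.card_cons, Multiset.prod_cons, pow_succ']
    rcases eq_or_ne s 0 with rfl | hs'
    · simpa using ha
    · exact mul_lt_mul'' ha (ih hs' fun b hb => h b (Multiset.mem_cons_of_mem hb)) hc.le
        (by positivity)

theorem norm_multiset_prod_le_pow {C : Type*} [NormedField C] {r : ℝ} (s : Multiset C)
    (h : ∀ a ∈ s, ‖a‖ ≤ r) : ‖s.prod‖ ≤ r ^ s.card := by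
  induction s using Multiset.induction_on with
  | empty => simp
  | cons a s ih =>
    have ha := h a (Multiset.mem_cons_self a s)
    rw [Multiset.card_cons, Multiset.prod_cons, pow_succ', norm_mul]
    exact mul_le_mul ha (ih fun b hb => h b (Multiset.mem_cons_of_mem hb)) (norm_nonneg _)
      ((norm_nonneg _).trans ha)

section Ultrametric

variable {C : Type*} [NormedField C] [IsUltrametricDist C]

theorem norm_natCast_eq_one_of_not_dvd {p : ℕ} (hp : p.Prime) (hpC : ‖(p : C)‖ < 1) {m : ℕ}
    (hm : ¬ p ∣ m) : ‖(m : C)‖ = 1 := by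
  refine le_antisymm (IsUltrametricDist.norm_natCast_le_one C m) ?_
  by_contra! hlt
  have hco : IsCoprime (p : ℤ) (m : ℤ) :=
    Nat.isCoprime_iff_coprime.2 ((Nat.Prime.coprime_iff_not_dvd hp).2 hm)
  obtain ⟨a, b, hab⟩ := hco
  have habC : (a : C) * (p : C) + (b : C) * (m : C) = 1 := by
    exact_mod_cast congrArg (Int.cast : ℤ → C) hab
  have h1 : ‖(a : C) * (p : C)‖ < 1 := by
    rw [norm_mul]
    exact mul_lt_one_of_nonneg_of_lt_one_right (IsUltrametricDist.norm_intCast_le_one C a)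
      (norm_nonneg _) hpC
  have h2 : ‖(b : C) * (m : C)‖ < 1 := by
    rw [norm_mul]
    exact mul_lt_one_of_nonneg_of_lt_one_right (IsUltrametricDist.norm_intCast_le_one C b)
      (norm_nonneg _) hlt
  have := (IsUltrametricDist.norm_add_le_max _ _).trans_lt (max_lt h1 h2)
  rw [habC, norm_one] at this
  exact lt_irrefl _ this

/-- If all roots of a split monic polynomial lie within distance `r` of `y`, then the value at `y`
of its `q`-th Hasse derivative has norm at most `r ^ (deg - q)`. -/
theorem norm_eval_hasseDeriv_le {r : ℝ} (s : Multiset C) (y : C)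
    (h : ∀ a ∈ s, ‖y - a‖ ≤ r) {q : ℕ} (hq : q ≤ s.card) :
    ‖(hasseDeriv q (s.map fun a => X - Polynomial.C a).prod).eval y‖ ≤ r ^ (s.card - q) := by
  have htaylor : taylor y (s.map fun a => X - Polynomial.C a).prod =
      (s.map fun a => X + Polynomial.C (y - a)).prod := by
    rw [← taylorAlgHom_apply, map_multiset_prod, Multiset.map_map]
    congr 1
    refine Multiset.map_congr rfl fun a _ => ?_
    simp [taylor_X, taylor_C]
    ring
  rw [← taylor_coeff, htaylor, Multiset.prod_X_add_C_coeff' _ _ hq, Multiset.esymm]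
  obtain ⟨t, ht, hle⟩ := IsUltrametricDist.exists_norm_multiset_sum_le
    (((s.map fun a => y - a).powersetCard (s.card - q))) (f := Multiset.prod)
  replace ht := ht (by simp [← Multiset.card_pos, Nat.choose_pos])
  refine hle.trans ?_
  obtain ⟨ht1, ht2⟩ := Multiset.mem_powersetCard.1 ht
  rw [← ht2]
  refine norm_multiset_prod_le_pow t fun a ha => ?_
  obtain ⟨b, hb, rfl⟩ := Multiset.mem_map.1 (Multiset.mem_of_le ht1 ha)
  exact h b hb

end Ultrametric

section Ax

variable {L C : Type*} [NontriviallyNormedField L] [IsUltrametricDist L] [CompleteSpace L]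
  [NormedField C] [NormedAlgebra L C]

/-- Conjugate elements over a complete ultrametric field have the same norm. -/
theorem norm_eq_of_minpoly_eq {a b : C} (ha : IsIntegral L a) (hb : IsIntegral L b)
    (h : minpoly L a = minpoly L b) : ‖a‖ = ‖b‖ := by
  let E := algebraicClosure L C
  let f : AbsoluteValue E ℝ :=
    { toFun := fun x => ‖(x : C)‖
      map_mul' := fun x y => by simp
      nonneg' := fun x => norm_nonneg _
      eq_zero' := fun x => by simp
      add_le' := fun x y => norm_add_le _ _ }
  have hf : ∀ x : L, f (algebraMap L E x) = ‖x‖ := fun x => norm_algebraMap' C x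
  have key : ∀ x : C, IsIntegral L x → ‖x‖ = spectralValue (minpoly L x) := by
    intro x hx
    let x' : E := ⟨x, (mem_algebraicClosure_iff).2 hx.isAlgebraic⟩
    have h1 : f x' = spectralNorm L E x' := spectralNorm_unique_field_norm_ext hf x'
    have h2 : minpoly L x' = minpoly L x :=
      (minpoly.algebraMap_eq (algebraMap E C).injective x').symm
    rw [spectralNorm, h2] at h1
    exact h1
  rw [key a ha, key b hb, h]

theorem map_hasseDeriv {R T : Type*} [Semiring R] [Semiring T] (φ : R →+* T) (q : ℕ) (f : R[X]) :
    (hasseDeriv q f).map φ = hasseDeriv q (f.map φ) := by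
  ext i
  simp [hasseDeriv_coeff]

theorem isIntegral_algebraMap_of_isAlgebraic {k K L C : Type*} [Field k] [Field K] [Field L]
    [Field C] [Algebra L C] [Algebra k K] [Algebra.IsAlgebraic k K] [Algebra k L] [Algebra k C]
    [IsScalarTower k L C] [Algebra K C] [IsScalarTower k K C] (x : K) :
    IsIntegral L (algebraMap K C x) :=
  (((Algebra.IsAlgebraic.isAlgebraic (R := k) x).isIntegral).algebraMap (B := C)).tower_top

/-- The minimal polynomial over `L` of an element of `K` has coefficients in `K`. -/
theorem exists_map_eq_map_minpoly {k K L C : Type*} [Field k] [Field K] [IsAlgClosed K] [Field L]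
    [Field C] [Algebra L C] [Algebra k K] [Algebra.IsAlgebraic k K] [Algebra k L] [Algebra k C]
    [IsScalarTower k L C] [Algebra K C] [IsScalarTower k K C] (x : K) :
    ∃ h : K[X], h.map (algebraMap K C) = (minpoly L (algebraMap K C x)).map (algebraMap L C) := by
  have hxk : IsIntegral k x := (Algebra.IsAlgebraic.isAlgebraic (R := k) x).isIntegral
  have hxL : IsIntegral L (algebraMap K C x) := isIntegral_algebraMap_of_isAlgebraic (k := k) x
  have hdvd : (minpoly L (algebraMap K C x)).map (algebraMap L C) ∣
      ((minpoly k x).map (algebraMap k K)).map (algebraMap K C) := by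
    have h := Polynomial.map_dvd (algebraMap L C)
      (minpoly.dvd_map_of_isScalarTower k L (algebraMap K C x))
    rwa [minpoly.algebraMap_eq (A := k) (algebraMap K C).injective, Polynomial.map_map,
      ← IsScalarTower.algebraMap_eq, IsScalarTower.algebraMap_eq k K C, ← Polynomial.map_map] at h
  have hsp : ((minpoly k x).map (algebraMap k K)).Splits := IsAlgClosed.splits _
  have hne : (minpoly k x).map (algebraMap k K) ≠ 0 := Polynomial.map_ne_zero (minpoly.ne_zero hxk)
  have hGsp := (hsp.map (algebraMap K C)).of_dvd (Polynomial.map_ne_zero hne) hdvd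
  have hlift := hGsp.mem_lift_of_roots_mem_range ((minpoly.monic hxL).map _) (algebraMap K C)
    fun a ha => hsp.mem_range_of_isRoot hne ((isRoot_of_mem_roots ha).dvd hdvd)
  exact (Polynomial.mem_lifts _).1 hlift

/-- **Ax's approximation lemma**: an element `y` of a complete field `L` is approximated by
elements of `L` algebraic over `k` almost as well as by arbitrary algebraic elements. -/
theorem exists_algebraic_norm_sub_le (k : Type*) {K : Type*} [Field k] [Field K] [IsAlgClosed K]
    [Algebra k K] [Algebra.IsAlgebraic k K] [Algebra k L] [Algebra k C] [IsScalarTower k L C]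
    [Algebra K C] [IsScalarTower k K C] [CharZero K] [IsUltrametricDist C] (p : ℕ)
    [hp : Fact p.Prime] (hpC : ‖(p : C)‖ < 1) (y : L) (n : ℕ) :
    ∀ x : K, (minpoly L (algebraMap K C x)).natDegree = n →
      ∃ (z : K) (w : L), algebraMap K C z = algebraMap L C w ∧
        ‖y - w‖ ≤ ‖algebraMap L C y - algebraMap K C x‖ * ‖(p : C)‖⁻¹ ^ (p - p / n : ℝ) := by
  have hp1 := hp.out.one_lt
  have : CharZero C := charZero_of_injective_algebraMap (algebraMap K C).injective
  have hp0 : 0 < ‖(p : C)‖ := norm_pos_iff.2 (Nat.cast_ne_zero.2 hp.out.ne_zero)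
  set A : ℝ := ‖(p : C)‖⁻¹ with hA
  have hA1 : 1 < A := (one_lt_inv₀ hp0).2 hpC
  have hA0 : 0 < A := one_pos.trans hA1
  induction n using Nat.strong_induction_on with
  | _ n ih =>
  intro x hxn
  have hxL : IsIntegral L (algebraMap K C x) := isIntegral_algebraMap_of_isAlgebraic (k := k) x
  have hn0 : 0 < n := hxn ▸ minpoly.natDegree_pos hxL
  rcases Nat.eq_or_lt_of_le (Nat.succ_le_of_lt hn0) with h1 | hn1
  · obtain ⟨w, hw⟩ := minpoly.natDegree_eq_one_iff.1 (hxn.trans h1.symm)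
    refine ⟨x, w, hw.symm, ?_⟩
    rw [← h1, ← hw, ← map_sub, norm_algebraMap']
    simp
  set r := ‖algebraMap L C y - algebraMap K C x‖ with hr
  rcases (norm_nonneg (algebraMap L C y - algebraMap K C x)).eq_or_lt' with hr0 | hr0
  · refine ⟨x, y, (sub_eq_zero.1 (norm_eq_zero.1 hr0)).symm, ?_⟩
    rw [sub_self, norm_zero]
    positivity
  rw [← hr] at hr0
  obtain ⟨q, hq0, hqn, hq⟩ := exists_choose_almost_unit p hn1
  obtain ⟨h, hh⟩ := exists_map_eq_map_minpoly (k := k) (L := L) (C := C) x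
  have hdeg : h.natDegree = n := by
    rw [← natDegree_map (algebraMap K C), hh, natDegree_map, hxn]
  have hmon : h.Monic := by
    refine Polynomial.monic_of_injective (algebraMap K C).injective ?_
    rw [hh]
    exact (minpoly.monic hxL).map _
  have hsplit : h = (h.roots.map fun a => X - Polynomial.C a).prod :=
    (IsAlgClosed.splits h).eq_prod_roots_of_monic hmon
  have hcard : h.roots.card = n := by
    rw [← hdeg, (IsAlgClosed.splits h).natDegree_eq_card_roots]
  have hconj : ∀ a ∈ h.roots, ‖algebraMap L C y - algebraMap K C a‖ = r := by
    intro a ha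
    have ha' : aeval (algebraMap K C a) (minpoly L (algebraMap K C x)) = 0 := by
      rw [← eval_map_algebraMap, ← hh, eval_map_apply, (mem_roots'.1 ha).2, map_zero]
    have hmin : minpoly L (algebraMap K C x) = minpoly L (algebraMap K C a) :=
      minpoly.eq_of_irreducible_of_monic (minpoly.irreducible hxL) ha' (minpoly.monic hxL)
    rw [hr, norm_sub_rev, norm_sub_rev _ (algebraMap K C x)]
    have haL : IsIntegral L (algebraMap K C a) := isIntegral_algebraMap_of_isAlgebraic (k := k) a
    refine norm_eq_of_minpoly_eq (L := L) (haL.sub isIntegral_algebraMap)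
      (hxL.sub isIntegral_algebraMap) ?_
    rw [minpoly.sub_algebraMap, minpoly.sub_algebraMap, hmin]
  have hDdeg : (hasseDeriv q h).natDegree = n - q := by rw [natDegree_hasseDeriv, hdeg]
  have hDsp := IsAlgClosed.splits (hasseDeriv q h)
  have hDcard : (hasseDeriv q h).roots.card = n - q := by
    rw [← hDsp.natDegree_eq_card_roots, hDdeg]
  have hlead : (hasseDeriv q h).leadingCoeff = (n.choose q : K) := by
    rw [leadingCoeff, hDdeg, hasseDeriv_coeff, Nat.sub_add_cancel hqn.le, ← hdeg,
      hmon.coeff_natDegree, mul_one]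
  have hupper : ‖((hasseDeriv q h).map (algebraMap K C)).eval (algebraMap L C y)‖ ≤
      r ^ (n - q) := by
    have := norm_eval_hasseDeriv_le (h.roots.map (algebraMap K C)) (algebraMap L C y)
      (by
        intro a ha
        obtain ⟨b, hb, rfl⟩ := Multiset.mem_map.1 ha
        exact (hconj b hb).le) (q := q) (by rw [Multiset.card_map, hcard]; exact hqn.le)
    rw [Multiset.card_map, hcard] at this
    rw [map_hasseDeriv]
    convert this using 4
    conv_lhs => rw [hsplit]
    rw [Polynomial.map_multiset_prod, Multiset.map_map, Multiset.map_map]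
    simp
  have hval : ‖((hasseDeriv q h).map (algebraMap K C)).eval (algebraMap L C y)‖ =
      ‖(n.choose q : C)‖ *
        ((hasseDeriv q h).roots.map fun b => ‖algebraMap L C y - algebraMap K C b‖).prod := by
    rw [(hDsp.map (algebraMap K C)).eval_eq_prod_roots, hDsp.roots_map, norm_mul,
      leadingCoeff_map, hlead, map_natCast]
    congr 1
    refine (map_multiset_prod (normHom (α := C)) _).trans ?_
    rw [Multiset.map_map, Multiset.map_map]
    rfl
  have hn : (0 : ℝ) < n := by exact_mod_cast hn0
  have hnq : (0 : ℝ) < (n - q : ℕ) := by exact_mod_cast Nat.sub_pos_of_lt hqn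
  have hcast : ((n - q : ℕ) : ℝ) = n - q := by push_cast [hqn.le]; ring
  obtain ⟨δ, hδ, hbinom⟩ : ∃ δ : ℝ, δ ≤ p / (n - q : ℕ) - p / n ∧
      1 ≤ (A ^ δ) ^ (n - q) * ‖(n.choose q : C)‖ := by
    rcases hq with hq | ⟨hnpq, m, hm, hpm⟩
    · refine ⟨0, sub_nonneg.2 ?_, ?_⟩
      · gcongr
        exact Nat.sub_le n q
      · rw [norm_natCast_eq_one_of_not_dvd hp.out hpC hq]
        simp
    · refine ⟨1 / (n - q : ℕ), le_of_eq ?_, le_of_eq ?_⟩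
      · rw [hcast] at hnq ⊢
        have : (n : ℝ) = p * q := by exact_mod_cast hnpq
        field_simp
        rw [this]
        ring
      · rw [hm, Nat.cast_mul, norm_mul, norm_natCast_eq_one_of_not_dvd hp.out hpC hpm, mul_one,
          ← Real.rpow_natCast, ← Real.rpow_mul hA0.le, one_div, inv_mul_cancel₀ hnq.ne',
          Real.rpow_one, hA, inv_mul_cancel₀ hp0.ne']
  obtain ⟨b, hb, hbr⟩ : ∃ b ∈ (hasseDeriv q h).roots,
      ‖algebraMap L C y - algebraMap K C b‖ ≤ r * A ^ δ := by
    by_contra! hcon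
    have hc : 0 < r * A ^ δ := by positivity
    have := pow_card_lt_multiset_prod hc
      ((hasseDeriv q h).roots.map fun b => ‖algebraMap L C y - algebraMap K C b‖)
      (by rw [← Multiset.card_pos, Multiset.card_map, hDcard]; omega)
      (by
        intro a ha
        obtain ⟨b, hb, rfl⟩ := Multiset.mem_map.1 ha
        exact hcon b hb)
    rw [Multiset.card_map, hDcard, mul_pow] at this
    have hN0 : 0 < ‖(n.choose q : C)‖ :=
      norm_pos_iff.2 (Nat.cast_ne_zero.2 (Nat.choose_pos hqn.le).ne')
    have h2 := mul_lt_mul_of_pos_left this hN0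
    rw [← hval] at h2
    have h3 : r ^ (n - q) ≤ ‖(n.choose q : C)‖ * (r ^ (n - q) * (A ^ δ) ^ (n - q)) := by
      calc r ^ (n - q) ≤ r ^ (n - q) * ((A ^ δ) ^ (n - q) * ‖(n.choose q : C)‖) :=
            le_mul_of_one_le_right (by positivity) hbinom
        _ = _ := by ring
    exact absurd (h3.trans_lt h2) (not_lt.2 hupper)
  have hbdeg : (minpoly L (algebraMap K C b)).natDegree ≤ n - q := by
    have hroot : aeval (algebraMap K C b) (hasseDeriv q (minpoly L (algebraMap K C x))) = 0 := by
      rw [← eval_map_algebraMap, map_hasseDeriv, ← hh, ← map_hasseDeriv, eval_map_apply,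
        (mem_roots'.1 hb).2, map_zero]
    have hne : hasseDeriv q (minpoly L (algebraMap K C x)) ≠ 0 := by
      intro h0
      have : hasseDeriv q h = 0 := by
        refine (Polynomial.map_eq_zero (algebraMap K C)).1 ?_
        rw [map_hasseDeriv, hh, ← map_hasseDeriv, h0, Polynomial.map_zero]
      rw [this] at hb
      simp at hb
    calc _ ≤ (hasseDeriv q (minpoly L (algebraMap K C x))).natDegree :=
          natDegree_le_of_dvd (minpoly.dvd L _ hroot) hne
      _ ≤ _ := by rw [← hxn]; exact natDegree_hasseDeriv_le _ _
  obtain ⟨z, w, hzw, hle⟩ := ih _ (hbdeg.trans_lt (by omega)) b rfl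
  refine ⟨z, w, hzw, hle.trans ?_⟩
  have hbpos : (0 : ℝ) < (minpoly L (algebraMap K C b)).natDegree := by
    exact_mod_cast minpoly.natDegree_pos (isIntegral_algebraMap_of_isAlgebraic (k := k) b)
  calc _ ≤ (r * A ^ δ) * A ^ (p - p / (n - q : ℕ) : ℝ) := by
        refine mul_le_mul hbr (Real.rpow_le_rpow_of_exponent_le hA1.le ?_) (by positivity)
          (by positivity)
        gcongr
    _ = r * A ^ (δ + (p - p / (n - q : ℕ)) : ℝ) := by rw [mul_assoc, ← Real.rpow_add hA0]
    _ ≤ _ := by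
        gcongr
        · exact hA1.le
        · linarith

end Ax

namespace AddVal

/-- The order-reversing map from additive values to multiplicative ones, `γ ↦ 2 ^ (-γ)`. -/
def mulValue (a : WithTop ℚ) : ℝ := a.recTopCoe 0 fun q => (2 : ℝ) ^ (-(q : ℝ))

@[simp] theorem mulValue_top : mulValue ⊤ = 0 := rfl

@[simp] theorem mulValue_coe (q : ℚ) : mulValue q = (2 : ℝ) ^ (-(q : ℝ)) := rfl

theorem mulValue_strictAnti : StrictAnti mulValue := by
  intro a b hab
  induction a using WithTop.recTopCoe with
  | top => exact absurd hab not_top_lt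
  | coe a =>
    induction b using WithTop.recTopCoe with
    | top =>
      rw [mulValue_coe, mulValue_top]
      positivity
    | coe b =>
      rw [mulValue_coe, mulValue_coe]
      refine Real.rpow_lt_rpow_of_exponent_lt one_lt_two (neg_lt_neg ?_)
      exact_mod_cast hab

theorem mulValue_add (a b : WithTop ℚ) : mulValue (a + b) = mulValue a * mulValue b := by
  induction a using WithTop.recTopCoe with
  | top => simp
  | coe a =>
    induction b using WithTop.recTopCoe with
    | top => simp
    | coe b =>
      rw [← WithTop.coe_add, mulValue_coe, mulValue_coe, mulValue_coe, ← Real.rpow_add two_pos]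
      push_cast
      ring_nf

theorem mulValue_nonneg (a : WithTop ℚ) : 0 ≤ mulValue a :=
  mulValue_strictAnti.antitone le_top

theorem mulValue_eq_zero {a : WithTop ℚ} : mulValue a = 0 ↔ a = ⊤ :=
  mulValue_strictAnti.injective.eq_iff' mulValue_top

theorem exists_mulValue_lt {ε : ℝ} (hε : 0 < ε) : ∃ γ : ℚ, mulValue γ < ε := by
  obtain ⟨n, hn⟩ := exists_pow_lt_of_lt_one hε (by norm_num : (1 / 2 : ℝ) < 1)
  refine ⟨n, ?_⟩
  rw [mulValue_coe]
  simpa [Real.rpow_neg] using hn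

variable {K : Type} [Field K] (w : AddVal K)

theorem mulValue_add_le_max (x y : K) :
    mulValue (w.v (x + y)) ≤ max (mulValue (w.v x)) (mulValue (w.v y)) :=
  (mulValue_strictAnti.antitone (w.min_le_v_add x y)).trans
    (mulValue_strictAnti.antitone.map_min).le

/-- The absolute value attached to an additive valuation. -/
def absVal : AbsoluteValue K ℝ where
  toFun x := mulValue (w.v x)
  map_mul' x y := by rw [w.v_mul, mulValue_add]
  nonneg' x := mulValue_nonneg _
  eq_zero' x := mulValue_eq_zero.trans (w.v_eq_top_iff x)
  add_le' x y := (w.mulValue_add_le_max x y).trans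
    (max_le_add_of_nonneg (mulValue_nonneg _) (mulValue_nonneg _))

theorem absVal_lt_mulValue_iff {x : K} {γ : WithTop ℚ} : w.absVal x < mulValue γ ↔ γ < w.v x :=
  mulValue_strictAnti.lt_iff_gt

theorem v_sub_comm (x y : K) : w.v (x - y) = w.v (y - x) :=
  mulValue_strictAnti.injective (w.absVal.map_sub x y)

theorem v_eq_of_lt_v_sub {x y : K} (h : w.v x < w.v (x - y)) : w.v y = w.v x := by
  have h1 : min (w.v x) (w.v (x - y)) ≤ w.v y := by
    have := w.min_le_v_add x (y - x)
    rwa [add_sub_cancel, w.v_sub_comm y x] at this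
  have h2 : min (w.v (x - y)) (w.v y) ≤ w.v x := by
    have := w.min_le_v_add (x - y) y
    rwa [sub_add_cancel] at this
  rw [min_eq_left h.le] at h1
  exact le_antisymm ((min_le_iff.1 h2).resolve_left (not_le.2 h)) h1

end AddVal

/-- Every subfield `F` of `ℂ_p` containing `ℚ_p` lies in the closure of the field `N` of algebraic
numbers belonging to the closure of `F`. -/
theorem CpSetup.exists_dense_algebraic (p : ℕ) [hp : Fact p.Prime] (S : CpSetup p)
    (F : Subfield S.Cp) (hF : ∀ c : ℚ_[p], qpHomC p S c ∈ F) :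
    ∃ N : IntermediateField ℚ_[p] (Qpbar p),
      (∀ z ∈ N, ∀ γ : ℚ, ∃ a ∈ F, (γ : WithTop ℚ) < S.vC.v (S.emb z - a)) ∧
      ∀ y ∈ F, ∀ γ : ℚ, ∃ z ∈ N, (γ : WithTop ℚ) < S.vC.v (S.emb z - y) := by
  let : NormedField S.Cp := S.vC.absVal.toNormedField
  have hnorm : ∀ x : S.Cp, ‖x‖ = S.vC.absVal x := fun _ => rfl
  have : IsUltrametricDist S.Cp :=
    IsUltrametricDist.isUltrametricDist_of_forall_norm_add_le_max_norm S.vC.mulValue_add_le_max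
  have : CompleteSpace S.Cp := by
    refine UniformSpace.complete_of_cauchySeq_tendsto fun s hs => ?_
    rw [Metric.cauchySeq_iff] at hs
    obtain ⟨l, hl⟩ := S.complete s fun γ => by
      obtain ⟨n, hn⟩ := hs (AddVal.mulValue γ) (Real.rpow_pos_of_pos two_pos _)
      refine ⟨n, fun i hi j hj => ?_⟩
      rw [← AddVal.absVal_lt_mulValue_iff, ← hnorm, ← dist_eq_norm]
      exact hn i hi j hj
    refine ⟨l, Metric.tendsto_atTop.2 fun ε hε => ?_⟩
    obtain ⟨γ, hγ⟩ := AddVal.exists_mulValue_lt hε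
    obtain ⟨n, hn⟩ := hl γ
    refine ⟨n, fun i hi => ?_⟩
    rw [dist_eq_norm, hnorm]
    exact ((AddVal.absVal_lt_mulValue_iff _).2 (hn i hi)).trans hγ
  let : Algebra ℚ_[p] S.Cp := (qpHomC p S).toAlgebra
  let : Algebra (Qpbar p) S.Cp := S.emb.toAlgebra
  have : IsScalarTower ℚ_[p] (Qpbar p) S.Cp := IsScalarTower.of_algebraMap_eq fun _ => rfl
  let L : Subfield S.Cp := F.topologicalClosure
  have hFL : F ≤ L := F.le_topologicalClosure
  let : Algebra ℚ_[p] L := ((qpHomC p S).codRestrict L fun c => hFL (hF c)).toAlgebra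
  have : IsScalarTower ℚ_[p] L S.Cp := IsScalarTower.of_algebraMap_eq fun _ => rfl
  have hpnorm : ‖(p : S.Cp)‖ = AddVal.mulValue ((1 : ℚ) : WithTop ℚ) := by
    have h1 := S.vbar_extends p (Nat.cast_ne_zero.2 hp.out.ne_zero)
    rw [map_natCast, Padic.valuation_p, ← S.vC_emb, map_natCast] at h1
    rw [hnorm]
    exact congrArg AddVal.mulValue (by simpa using h1)
  have hp1 : ‖(p : S.Cp)‖ < 1 := by
    rw [hpnorm, AddVal.mulValue_coe]
    exact Real.rpow_lt_one_of_one_lt_of_neg one_lt_two (by norm_num)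
  have hp0 : (p : S.Cp) ≠ 0 := by
    rw [← norm_pos_iff, hpnorm, AddVal.mulValue_coe]
    positivity
  let : NontriviallyNormedField L := NontriviallyNormedField.ofNormNeOne
    ⟨(p : L), fun h => hp0 (congrArg Subtype.val h), fun h => hp1.ne h⟩
  have : CompleteSpace L := F.isClosed_topologicalClosure.completeSpace_coe
  let : NormedAlgebra L S.Cp := { norm_smul_le := fun a b => (norm_mul (a : S.Cp) b).le }
  have : IsUltrametricDist L := inferInstance
  refine ⟨(L.comap S.emb).toIntermediateField fun c => hFL (hF c), ?_, ?_⟩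
  · intro z hz γ
    obtain ⟨a, ha, hza⟩ := Metric.mem_closure_iff.1 (show S.emb z ∈ closure (F : Set S.Cp) from hz)
      (AddVal.mulValue γ) (Real.rpow_pos_of_pos two_pos _)
    refine ⟨a, ha, ?_⟩
    rw [← AddVal.absVal_lt_mulValue_iff, ← hnorm, ← dist_eq_norm]
    exact hza
  · intro y hy γ
    have hA : 1 ≤ ‖(p : S.Cp)‖⁻¹ := (one_le_inv₀ (norm_pos_iff.2 hp0)).2 hp1.le
    have hA0 : 0 < ‖(p : S.Cp)‖⁻¹ ^ (p : ℝ) := Real.rpow_pos_of_pos (one_pos.trans_le hA) _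
    obtain ⟨γ', hγ'⟩ := AddVal.exists_mulValue_lt
      (div_pos (Real.rpow_pos_of_pos two_pos _ : 0 < AddVal.mulValue γ) hA0)
    obtain ⟨s, hs⟩ := S.dense y
    obtain ⟨n, hn⟩ := hs γ'
    have hn' : ‖y - S.emb (s n)‖ < AddVal.mulValue γ' := by
      rw [norm_sub_rev, hnorm, AddVal.absVal_lt_mulValue_iff]
      exact hn n le_rfl
    obtain ⟨z, w, hzw, hle⟩ := exists_algebraic_norm_sub_le (C := S.Cp) ℚ_[p] p hp1
      (⟨y, hFL hy⟩ : L) _ (s n) rfl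
    refine ⟨z, (show S.emb z ∈ L from hzw ▸ w.2), ?_⟩
    rw [← AddVal.absVal_lt_mulValue_iff, ← hnorm, norm_sub_rev]
    have hzw' : S.emb z = w := hzw
    rw [hzw']
    refine lt_of_le_of_lt (hle.trans ?_) ((lt_div_iff₀ hA0).1 (hn'.trans hγ'))
    refine mul_le_mul_of_nonneg_left (Real.rpow_le_rpow_of_exponent_le hA ?_) (norm_nonneg _)
    exact sub_le_self _ (by positivity)

namespace AddVal

variable {K : Type} [Field K] (w : AddVal K)

theorem v_one : w.v 1 = 0 := by
  refine mulValue_strictAnti.injective (w.absVal.map_one.trans ?_)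
  simpa using (mulValue_coe 0).symm

theorem v_zpow {x : K} {γ : ℚ} (hx : w.v x = (γ : WithTop ℚ)) (n : ℤ) :
    w.v (x ^ n) = ((n * γ : ℚ) : WithTop ℚ) := by
  refine mulValue_strictAnti.injective ((map_zpow₀ w.absVal x n).trans ?_)
  have h : w.absVal x = mulValue γ := congrArg mulValue hx
  rw [h, mulValue_coe, mulValue_coe, ← Real.rpow_intCast, ← Real.rpow_mul zero_le_two]
  push_cast
  ring_nf

end AddVal

/-- The value set of an intermediate field is a subgroup of `ℚ`. -/
def valGroup (p : ℕ) [Fact p.Prime] (S : PadicSetup p) (F : IntermediateField ℚ_[p] (Qpbar p)) :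
    AddSubgroup ℚ where
  carrier := valSetF p S F
  add_mem' := by
    rintro a b ⟨x, hx, hxa⟩ ⟨y, hy, hyb⟩
    exact ⟨x * y, mul_mem hx hy, by rw [S.vbar.v_mul, hxa, hyb, WithTop.coe_add]⟩
  zero_mem' := ⟨1, one_mem F, S.vbar.v_one⟩
  neg_mem' := by
    rintro a ⟨x, hx, hxa⟩
    refine ⟨x ^ (-1 : ℤ), zpow_mem hx _, ?_⟩
    rw [S.vbar.v_zpow hxa]
    simp

theorem valSetF_mono {p : ℕ} [Fact p.Prime] {S : PadicSetup p}
    {F F' : IntermediateField ℚ_[p] (Qpbar p)} (h : F ≤ F') : valSetF p S F ⊆ valSetF p S F' :=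
  fun _ ⟨x, hx, hxa⟩ => ⟨x, h hx, hxa⟩

/-- An additive subgroup of `ℚ` with bounded denominators is cyclic. -/
theorem HasFiniteRamification.exists_generator {G : AddSubgroup ℚ}
    (hG : HasFiniteRamification (G : Set ℚ)) : ∃ g ∈ G, ∀ x ∈ G, ∃ n : ℤ, x = n * g := by
  obtain ⟨e, he, hG⟩ := hG
  have he' : (e : ℚ) ≠ 0 := by exact_mod_cast he.ne'
  obtain ⟨m, hm⟩ := Int.subgroup_cyclic
    (G.comap ((AddMonoidHom.mulRight ((e : ℚ)⁻¹)).comp (Int.castAddHom ℚ)))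
  have hmem : ∀ k : ℤ, (k : ℚ) * (e : ℚ)⁻¹ ∈ G ↔ ∃ n : ℤ, n * m = k := by
    intro k
    have h := SetLike.ext_iff.1 hm k
    rw [AddSubgroup.mem_closure_singleton] at h
    simpa using h
  refine ⟨m * (e : ℚ)⁻¹, (hmem m).2 ⟨1, one_mul m⟩, fun x hx => ?_⟩
  obtain ⟨k, hk⟩ := hG x hx
  have hxk : x = k * (e : ℚ)⁻¹ := by
    rw [← hk]
    field_simp
  obtain ⟨n, rfl⟩ := (hmem k).1 (hxk ▸ hx)
  refine ⟨n, hxk.trans ?_⟩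
  push_cast
  ring

/-- An intermediate field whose value group has bounded denominators is contained in the maximal
unramified extension of a finite extension of `ℚ_p`. -/
theorem exists_finite_le_maxUnramified {p : ℕ} [Fact p.Prime] {S : PadicSetup p}
    {N : IntermediateField ℚ_[p] (Qpbar p)} (hN : HasFiniteRamification (valSetF p S N)) :
    ∃ K : IntermediateField ℚ_[p] (Qpbar p), FiniteDimensional ℚ_[p] K ∧
      ∀ x ∈ N, x ∈ maxUnramified p S K := by
  obtain ⟨g, ⟨a, ha, hag⟩, hg⟩ := HasFiniteRamification.exists_generator (G := valGroup p S N) hN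
  refine ⟨IntermediateField.adjoin ℚ_[p] {a}, IntermediateField.adjoin.finiteDimensional
    (Algebra.IsIntegral.isIntegral a), fun x hx => ?_⟩
  refine (valSetF_mono le_sup_left).antisymm' fun γ hγ => ?_
  have hle : IntermediateField.adjoin ℚ_[p] {a} ⊔ IntermediateField.adjoin ℚ_[p] {x} ≤ N :=
    sup_le (IntermediateField.adjoin_simple_le_iff.2 ha)
      (IntermediateField.adjoin_simple_le_iff.2 hx)
  obtain ⟨n, rfl⟩ := hg γ (valSetF_mono hle hγ)
  exact ⟨a ^ n, zpow_mem (IntermediateField.mem_adjoin_simple_self _ a) n, S.vbar.v_zpow hag n⟩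

/-- The elements of `ℚ_p(t)` form a subfield of `ℂ_p` that contains `ℚ_p` and `t`. -/
theorem exists_subfield_inQpAlpha (p : ℕ) [Fact p.Prime] (S : CpSetup p) (t : S.Cp) :
    ∃ F : Subfield S.Cp, (∀ c : ℚ_[p], qpHomC p S c ∈ F) ∧ t ∈ F ∧
      ∀ x ∈ F, InQpAlpha p S t x := by
  let : Algebra ℚ_[p] S.Cp := (qpHomC p S).toAlgebra
  refine ⟨(IntermediateField.adjoin ℚ_[p] {t}).toSubfield,
    (IntermediateField.adjoin ℚ_[p] {t}).algebraMap_mem,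
    IntermediateField.mem_adjoin_simple_self _ t, fun x hx => ?_⟩
  obtain ⟨f, g, rfl⟩ := (IntermediateField.mem_adjoin_simple_iff _ _).1 hx
  by_cases hg : aeval t g = 0
  · refine ⟨0, 1, by simp, ?_⟩
    rw [hg]
    simp
  · exact ⟨f, g, hg, rfl⟩

/-- Let `t ∈ ℂ_p` be of bounded ramification, i.e. the ramification index
`e_t` of `ℚ_p(t)/ℚ_p` is finite.  Then `t` is the limit (in `ℂ_p`) of a sequence contained
in the maximal unramified extension of some finite extension of `ℚ_p`. -/
theorem stmt_11 (p : ℕ) [Fact p.Prime] (S : CpSetup p) (t : S.Cp)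
    (hram : HasFiniteRamification (valSetCp p S t)) :
    ∃ K : IntermediateField ℚ_[p] (Qpbar p), FiniteDimensional ℚ_[p] K ∧
      ∃ u : ℕ → Qpbar p, (∀ n : ℕ, u n ∈ maxUnramified p S.toPadicSetup K) ∧
        S.vC.TendsToVal (fun n => S.emb (u n)) t := by
  obtain ⟨F, hF, htF, hFt⟩ := exists_subfield_inQpAlpha p S t
  obtain ⟨N, hNF, hFN⟩ := S.exists_dense_algebraic p F hF
  obtain ⟨e, he, hram⟩ := hram
  obtain ⟨K, hK, hNK⟩ := exists_finite_le_maxUnramified (S := S.toPadicSetup) (N := N) (by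
    refine ⟨e, he, fun γ ⟨z, hz, hzγ⟩ => ?_⟩
    rw [← S.vC_emb] at hzγ
    obtain ⟨a, ha, hza⟩ := hNF z hz γ
    rw [← hzγ] at hza
    exact hram γ ⟨a, hFt a ha, (S.vC.v_eq_of_lt_v_sub hza).trans hzγ⟩)
  choose u hu hut using fun n : ℕ => hFN t htF n
  refine ⟨K, hK, u, fun n => hNK _ (hu n), fun γ => ?_⟩
  obtain ⟨n, hn⟩ := exists_nat_gt γ
  refine ⟨n, fun m hm => lt_trans ?_ (hut m)⟩
  exact_mod_cast hn.trans_le (Nat.cast_le.2 hm)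

end
end
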